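/- arXiv:2603.09475 — 2 statements merged into one kernel-verified Lean document; each statement's English description precedes it below -/
import Mathlib

section
/- Lemma (odd cylinders): Let G = C_p □ P_q be a cylinder with p ≥ 3 odd and q ≥ 1, and let T ⊆ V(G). If q is even and T satisfies condition P, then G admits an acyclic T-odd orientation. If q is odd and T satisfies conditions P, S and S̄, then G admits an acyclic T-odd orientation. -/
open SimpleGraph

section Defs

variable {V : Type*}

/-- An orientation of a simple graph: each edge gets exactly one direction. -/
structure GraphOrientation {V : Type*} (G : SimpleGraph V) where
  dir : V → V → Prop
  dir_adj : ∀ u v, dir u v → G.Adj u v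
  dir_choice : ∀ u v, G.Adj u v → (dir u v ↔ ¬ dir v u)

/-- An orientation is acyclic if there is no directed cycle, i.e. the transitive
closure of the arc relation is irreflexive. -/
def GraphOrientation.Acyclic {G : SimpleGraph V} (o : GraphOrientation G) : Prop :=
  Irreflexive (Relation.TransGen o.dir)

/-- In-degree of a vertex in an orientation. -/
noncomputable def GraphOrientation.indeg {G : SimpleGraph V} (o : GraphOrientation G)
    (v : V) : ℕ :=
  Set.ncard {u | o.dir u v}

/-- An orientation is `T`-odd if a vertex has odd in-degree iff it belongs to `T`. -/
def GraphOrientation.IsTOdd {G : SimpleGraph V} (o : GraphOrientation G) (T : Set V) : Prop :=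
  ∀ v, Odd (o.indeg v) ↔ v ∈ T

/-- `G` admits an acyclic `T`-odd orientation. -/
def HasAcyclicTOddOrientation (G : SimpleGraph V) (T : Set V) : Prop :=
  ∃ o : GraphOrientation G, o.Acyclic ∧ o.IsTOdd T

/-- Degree of a vertex. -/
noncomputable def vdeg (G : SimpleGraph V) (v : V) : ℕ := (G.neighborSet v).ncard

/-- Potential sources: `V \ T`. -/
def sourceSet (T : Set V) : Set V := Tᶜ

/-- Potential sinks. -/
def sinkSet (G : SimpleGraph V) (T : Set V) : Set V :=
  {v | (v ∈ T ∧ Odd (vdeg G v)) ∨ (v ∉ T ∧ Even (vdeg G v))}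

/-- Parity condition `𝒫`: `|E| + |T|` is even. -/
def CondP (G : SimpleGraph V) (T : Set V) : Prop :=
  Even (G.edgeSet.ncard + T.ncard)

/-- Source condition `𝒮`. -/
def CondS (G : SimpleGraph V) (T : Set V) : Prop :=
  (sourceSet T).Nonempty ∧
    ((sourceSet T).ncard = 1 → Nat.card V = 1 ∨ sourceSet T ≠ sinkSet G T)

/-- Sink condition `𝒮̄`. -/
def CondSbar (G : SimpleGraph V) (T : Set V) : Prop :=
  (sinkSet G T).Nonempty ∧
    ((sinkSet G T).ncard = 1 → Nat.card V = 1 ∨ sinkSet G T ≠ sourceSet T)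

/-- Membership in the class `C_P`. -/
def MemCP (G : SimpleGraph V) : Prop :=
  ∀ T : Set V, CondP G T → HasAcyclicTOddOrientation G T

/-- Membership in the class `C_{P,S}`. -/
def MemCPS (G : SimpleGraph V) : Prop :=
  ∀ T : Set V, CondP G T → CondS G T → HasAcyclicTOddOrientation G T

/-- Membership in the class `C_{P,S̄}`. -/
def MemCPSbar (G : SimpleGraph V) : Prop :=
  ∀ T : Set V, CondP G T → CondSbar G T → HasAcyclicTOddOrientation G T

/-- Membership in the class `C_{P,S,S̄}`. -/
def MemCPSSbar (G : SimpleGraph V) : Prop :=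
  ∀ T : Set V, CondP G T → CondS G T → CondSbar G T → HasAcyclicTOddOrientation G T

/-- A graph is Eulerian if it is connected and every vertex has even degree. -/
def IsEulerianGraph (G : SimpleGraph V) : Prop :=
  G.Connected ∧ ∀ v : V, Even (vdeg G v)

end Defs

/-- The indicator of `a < b`, with values in `ZMod 2`. -/
def ltInd (a b : ℚ) : ZMod 2 := if a < b then 1 else 0

theorem ltInd_of_lt {a b : ℚ} (h : a < b) : ltInd a b = 1 := if_pos h

theorem ltInd_of_le {a b : ℚ} (h : b ≤ a) : ltInd a b = 0 := if_neg h.not_gt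

theorem ltInd_swap {a b : ℚ} (h : a ≠ b) : ltInd b a = 1 + ltInd a b := by
  rcases h.lt_or_gt with h | h
  · rw [ltInd_of_lt h, ltInd_of_le h.le]; decide
  · rw [ltInd_of_lt h, ltInd_of_le h.le]; decide

theorem ltInd_neg (a b : ℚ) : ltInd (-a) (-b) = ltInd b a := by
  simp [ltInd]

theorem ltInd_add_right (a b c : ℚ) : ltInd (a + c) (b + c) = ltInd a b := by
  simp [ltInd]

theorem ZMod.two_eq_zero_or_one (a : ZMod 2) : a = 0 ∨ a = 1 := by
  revert a; decide

theorem exists_forall_lt {n : ℕ} (h : Fin n → ℚ) : ∃ L, ∀ k, L < h k := by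
  obtain ⟨b, hb⟩ := (Set.finite_range h).bddBelow
  exact ⟨b - 1, fun k => by have := hb ⟨k, rfl⟩; linarith⟩

section Ring

variable {n : ℕ} [NeZero n]

theorem Fin.val_add_one_cyclic (hn : 3 ≤ n) (k : Fin n) :
    (k + 1).val = if k.val + 1 = n then 0 else k.val + 1 := by
  have hk := k.isLt
  rw [Fin.val_add, show (1 : Fin n).val = 1 by
    rw [Fin.val_one', Nat.mod_eq_of_lt (by omega)]]
  split_ifs with h
  · rw [h, Nat.mod_self]
  · exact Nat.mod_eq_of_lt (by omega)

theorem Fin.val_sub_one_cyclic (hn : 3 ≤ n) (k : Fin n) :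
    (k - 1).val = if k.val = 0 then n - 1 else k.val - 1 := by
  have h := Fin.val_add_one_cyclic hn (k - 1)
  rw [sub_add_cancel] at h
  have hk := (k - 1).isLt
  split_ifs at h ⊢ <;> omega

/-- The parity of the in-degree of `k` on the cycle, when edges point towards higher rank. -/
def ringParity (g : Fin n → ℚ) (k : Fin n) : ZMod 2 :=
  ltInd (g (k - 1)) (g k) + ltInd (g (k + 1)) (g k)

theorem ringParity_neg {g : Fin n → ℚ} (hg : ∀ k, g k ≠ g (k + 1)) (k : Fin n) :
    ringParity (fun j => -g j) k = ringParity g k := by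
  have h1 := hg (k - 1)
  rw [sub_add_cancel] at h1
  simp only [ringParity, ltInd_neg]
  rw [ltInd_swap h1, ltInd_swap (hg k)]
  generalize ltInd _ _ = a
  generalize ltInd _ _ = b
  revert a b; decide

theorem ringParity_add (g : Fin n → ℚ) (c : ℚ) (k : Fin n) :
    ringParity (fun j => g j + c) k = ringParity g k := by
  simp only [ringParity, ltInd_add_right]

theorem exists_ring_of_zero (hn : 3 ≤ n) {A : Fin n → ZMod 2} (hA : ∑ k, A k = n) (h0 : A 0 = 0) :
    ∃ g : Fin n → ℚ, (∀ k, g k ≠ g (k + 1)) ∧ ∀ k, ringParity g k = A k := by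
  let b : ℕ → ZMod 2 := fun m => if h : m < n then A ⟨m, h⟩ else 0
  have hb : ∀ k : Fin n, b k.val = A k := fun k => by simp [b]
  let e : ℕ → ZMod 2 := fun j => 1 + ∑ m ∈ Finset.range j, (1 + b (m + 1))
  have he0 : e 0 = 1 := by simp [e]
  have hes : ∀ j, e (j + 1) = e j + 1 + b (j + 1) := fun j => by
    simp only [e, Finset.sum_range_succ]; ring
  have hlast : e (n - 1) = 0 := by
    have h1 : ∑ m ∈ Finset.range n, b m = n := by
      rw [← hA, Finset.sum_range]
      exact Finset.sum_congr rfl fun k _ => hb k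
    obtain ⟨m, rfl⟩ : ∃ m, n = m + 1 := ⟨n - 1, by omega⟩
    rw [Finset.sum_range_succ'] at h1
    have hb0 : b 0 = 0 := by rw [← h0]; exact hb 0
    rw [hb0, add_zero] at h1
    simp only [e, Nat.add_sub_cancel, Finset.sum_add_distrib, h1]
    simp
    generalize (m : ZMod 2) = x
    revert x; decide
  let s : ℕ → ℚ := fun j => if e j = 1 then 1 else -1
  let h : ℕ → ℚ := fun j => if j = 0 then -2 * n else ∑ m ∈ Finset.range (j - 1), s (m + 1)
  have hbound : ∀ j : ℕ, -(j : ℚ) ≤ ∑ m ∈ Finset.range j, s (m + 1) := fun j => by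
    induction j with
    | zero => simp
    | succ j ih =>
      rw [Finset.sum_range_succ]
      have : -1 ≤ s (j + 1) := by simp only [s]; split_ifs <;> norm_num
      push_cast; linarith
  have hlow : ∀ j, 1 ≤ j → j ≤ n → h 0 < h j := fun j h1 h2 => by
    have h3 := hbound (j - 1)
    have h4 : ((j - 1 : ℕ) : ℚ) ≤ n := by exact_mod_cast (by omega : j - 1 ≤ n)
    have h5 : (3 : ℚ) ≤ n := by exact_mod_cast hn
    simp only [h, if_neg (show j ≠ 0 by omega), if_true]
    linarith
  have hstep : ∀ j, 1 ≤ j → h (j + 1) = h j + s j := fun j h1 => by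
    obtain ⟨m, rfl⟩ : ∃ m, j = m + 1 := ⟨j - 1, by omega⟩
    simp [h, Finset.sum_range_succ]
  have hne : ∀ k : Fin n, h k.val ≠ h (k + 1).val := fun k => by
    have hk := k.isLt
    rw [Fin.val_add_one_cyclic hn]
    split_ifs with h1
    · exact (hlow _ (by omega) hk.le).ne'
    · by_cases h2 : k.val = 0
      · rw [h2]; exact (hlow _ (by omega) (by omega)).ne
      · rw [hstep _ (by omega)]
        simp only [s]; split_ifs <;> simp
  have hlt : ∀ k : Fin n, ltInd (h k.val) (h (k + 1).val) = e k.val := fun k => by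
    have hk := k.isLt
    rw [Fin.val_add_one_cyclic hn]
    split_ifs with h1
    · rw [ltInd_of_le (hlow _ (by omega) hk.le).le, show k.val = n - 1 by omega, hlast]
    · by_cases h2 : k.val = 0
      · rw [h2, ltInd_of_lt (hlow _ (by omega) (by omega)), he0]
      · rw [hstep _ (by omega)]
        rcases ZMod.two_eq_zero_or_one (e k.val) with h3 | h3
        · rw [ltInd_of_le (by simp [s, h3]), h3]
        · rw [ltInd_of_lt (by simp [s, h3]), h3]
  refine ⟨fun k => h k.val, hne, fun k => ?_⟩
  have h1 := hlt (k - 1)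
  rw [sub_add_cancel] at h1
  simp only [ringParity]
  rw [h1, ltInd_swap (hne k), hlt k, ← hb k, Fin.val_sub_one_cyclic hn]
  split_ifs with h2
  · have : b 0 = 0 := by rw [← h0]; exact hb 0
    rw [h2, hlast, he0, this]; decide
  · have h3 := hes (k.val - 1)
    rw [Nat.sub_add_cancel (by omega)] at h3
    rw [h3]
    generalize e _ = x
    generalize b _ = y
    revert x y; decide

theorem exists_ring (hn : 3 ≤ n) {A : Fin n → ZMod 2} (hA : ∑ k, A k = n) {z : Fin n}
    (hz : A z = 0) :
    ∃ g : Fin n → ℚ, (∀ k, g k ≠ g (k + 1)) ∧ ∀ k, ringParity g k = A k := by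
  obtain ⟨g, hg, hp⟩ := exists_ring_of_zero hn (A := fun k => A (z + k))
    (by rw [← hA]; exact Equiv.sum_comp (Equiv.addLeft z) A) (by simpa using hz)
  refine ⟨fun k => g (k - z), fun k => ?_, fun k => ?_⟩
  · have := hg (k - z)
    rwa [show k - z + 1 = k + 1 - z by abel] at this
  · have := hp (k - z)
    simp only [ringParity] at this ⊢
    rwa [show k - z + 1 = k + 1 - z by abel, show k - z - 1 = k - 1 - z by abel,
      add_sub_cancel] at this

/-- Vertex `i` has a cycle neighbour of higher rank (`c = 0`) or lower rank (`c = 1`). -/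
def HasNeighbor (c : ZMod 2) (g : Fin n → ℚ) (i : Fin n) : Prop :=
  if c = 0 then g i < g (i + 1) ∨ g i < g (i - 1) else g (i + 1) < g i ∨ g (i - 1) < g i

theorem hasNeighbor_of_parity_one {g : Fin n → ℚ} (hg : ∀ k, g k ≠ g (k + 1)) {i : Fin n}
    (h : ringParity g i = 1) (c : ZMod 2) : HasNeighbor c g i := by
  have h1 := hg (i - 1)
  rw [sub_add_cancel] at h1
  have h2 := hg i
  simp only [ringParity, HasNeighbor] at h ⊢
  rcases h1.lt_or_gt with h1 | h1 <;> rcases h2.lt_or_gt with h2 | h2 <;>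
    simp [ltInd, h1, h2, h1.not_gt, h2.not_gt] at h ⊢

theorem exists_ring_hasNeighbor (hn : 3 ≤ n) {A : Fin n → ZMod 2} (hA : ∑ k, A k = n) {z : Fin n}
    (hz : A z = 0) (c : ZMod 2) (i : Fin n) :
    ∃ g : Fin n → ℚ, (∀ k, g k ≠ g (k + 1)) ∧ (∀ k, ringParity g k = A k) ∧
      HasNeighbor c g i := by
  obtain ⟨g, hg, hp⟩ := exists_ring hn hA hz
  by_cases h : HasNeighbor c g i
  · exact ⟨g, hg, hp, h⟩
  · refine ⟨fun k => -g k, fun k => by simpa using hg k,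
      fun k => by rw [ringParity_neg hg, hp], ?_⟩
    have h2 := hg i
    simp only [HasNeighbor] at h ⊢
    split_ifs at h ⊢ with hc
    · push Not at h
      left; simpa using lt_of_le_of_ne h.1 h2.symm
    · push Not at h
      left; simpa using lt_of_le_of_ne h.1 h2

theorem exists_pass_base (hn : 3 ≤ n) (hodd : Odd n) {w : Fin n → ℚ} (hw : w 0 < w 1) :
    ∃ g : Fin n → ℚ, (∀ k, g k ≠ g (k + 1)) ∧ (∀ k, g k ≠ w k) ∧
      (∀ k, ringParity g k + ltInd (w k) (g k) = 0) ∧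
      ∀ k, ltInd (g k) (w k) = 1 + if k = 0 then 1 else 0 := by
  obtain ⟨m, hm⟩ := hodd
  obtain ⟨L, hL⟩ := exists_forall_lt w
  have hL0 := hL 0
  let G : ℕ → ℚ := fun v => if v = 0 then (2 * w 0 + w 1) / 3 else
    if v = 1 then (w 0 + 2 * w 1) / 3 else if v % 2 = 0 then L - 1 else L
  have g0 : G 0 = (2 * w 0 + w 1) / 3 := by simp [G]
  have g1 : G 1 = (w 0 + 2 * w 1) / 3 := by simp [G]
  have heven : ∀ v, 2 ≤ v → v % 2 = 0 → G v = L - 1 := fun v h1 h2 => by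
    simp only [G]; rw [if_neg (by omega), if_neg (by omega), if_pos h2]
  have hodd' : ∀ v, 3 ≤ v → v % 2 = 1 → G v = L := fun v h1 h2 => by
    simp only [G]; rw [if_neg (by omega), if_neg (by omega), if_neg (by omega)]
  have hge : ∀ v, v = 0 ∨ v % 2 = 1 → L ≤ G v := fun v h => by
    simp only [G]; split_ifs
    · linarith
    · linarith
    · omega
    · exact le_rfl
  have key : ∀ k : Fin n, G k.val ≠ G (k + 1).val ∧ G k.val ≠ w k ∧
      ltInd (G (k - 1).val) (G k.val) + ltInd (G (k + 1).val) (G k.val) + ltInd (w k) (G k.val) =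
        0 ∧
      ltInd (G k.val) (w k) = 1 + if k = 0 then 1 else 0 := fun k => by
    have hk := k.isLt
    have hLk := hL k
    rw [Fin.val_add_one_cyclic hn, Fin.val_sub_one_cyclic hn]
    rcases (by omega : k.val = 0 ∨ k.val = 1 ∨ (2 ≤ k.val ∧ k.val % 2 = 0) ∨
      (3 ≤ k.val ∧ k.val % 2 = 1)) with h | h | ⟨h, h'⟩ | ⟨h, h'⟩
    · obtain rfl : k = 0 := Fin.ext (by simpa using h)
      rw [h, if_neg (by omega), if_pos rfl, if_pos rfl, zero_add,
        heven (n - 1) (by omega) (by omega),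
        g0, g1]
      refine ⟨by intro h; linarith, by intro h; linarith, ?_, ?_⟩
      · rw [ltInd_of_lt (by linarith), ltInd_of_le (by linarith), ltInd_of_lt (by linarith)]; decide
      · rw [ltInd_of_le (by linarith)]; decide
    · obtain rfl : k = 1 := Fin.ext (by rw [h, Fin.val_one', Nat.mod_eq_of_lt (by omega)])
      have h10 : (1 : Fin n) ≠ 0 := fun h0 => by rw [h0] at h; simp at h
      rw [h, if_neg (by omega), if_neg one_ne_zero, if_neg h10, heven (1 + 1) (by omega) (by omega),
        Nat.sub_self, g0, g1]
      refine ⟨by intro h; linarith, by intro h; linarith, ?_, ?_⟩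
      · rw [ltInd_of_lt (by linarith), ltInd_of_lt (by linarith), ltInd_of_le (by linarith)]; decide
      · rw [ltInd_of_lt (by linarith)]; decide
    · have h10 : k ≠ 0 := fun h0 => by rw [h0] at h; simp at h
      have e1 := hge (if k.val + 1 = n then 0 else k.val + 1) (by split_ifs <;> omega)
      have e2 := hge (k.val - 1) (by omega)
      rw [if_neg (show ¬ k.val = 0 by omega), if_neg h10, heven _ h h']
      refine ⟨by intro h; linarith, by intro h; linarith, ?_, ?_⟩
      · rw [ltInd_of_le (by linarith), ltInd_of_le (by linarith), ltInd_of_le (by linarith)]; decide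
      · rw [ltInd_of_lt (by linarith)]; decide
    · have h10 : k ≠ 0 := fun h0 => by rw [h0] at h; simp at h
      rw [if_neg (show ¬ k.val = 0 by omega), if_neg (show ¬ k.val + 1 = n by omega), if_neg h10,
        hodd' _ h h', heven _ (by omega) (by omega), heven _ (by omega) (by omega)]
      refine ⟨by intro h; linarith, by intro h; linarith, ?_, ?_⟩
      · rw [ltInd_of_lt (by linarith), ltInd_of_le (by linarith)]; decide
      · rw [ltInd_of_lt (by linarith)]; decide
  exact ⟨fun k => G k.val, fun k => (key k).1, fun k => (key k).2.1, fun k => (key k).2.2.1,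
    fun k => (key k).2.2.2⟩

theorem exists_pass_zero (hn : 3 ≤ n) (hodd : Odd n) {w : Fin n → ℚ} {i : Fin n}
    (hw : w i < w (i + 1) ∨ w i < w (i - 1)) :
    ∃ g : Fin n → ℚ, (∀ k, g k ≠ g (k + 1)) ∧ (∀ k, g k ≠ w k) ∧
      (∀ k, ringParity g k + ltInd (w k) (g k) = 0) ∧
      ∀ k, ltInd (g k) (w k) = 1 + if k = i then 1 else 0 := by
  rcases hw with hw | hw
  · obtain ⟨g, h1, h2, h3, h4⟩ := exists_pass_base hn hodd (w := fun j => w (i + j))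
      (by simpa using hw)
    refine ⟨fun k => g (k - i), fun k => ?_, fun k => ?_, fun k => ?_, fun k => ?_⟩
    · have := h1 (k - i)
      rwa [show k - i + 1 = k + 1 - i by abel] at this
    · simpa using h2 (k - i)
    · have := h3 (k - i)
      simp only [ringParity] at this ⊢
      rwa [show k - i + 1 = k + 1 - i by abel, show k - i - 1 = k - 1 - i by abel,
        add_sub_cancel] at this
    · simpa [sub_eq_zero] using h4 (k - i)
  · obtain ⟨g, h1, h2, h3, h4⟩ := exists_pass_base hn hodd (w := fun j => w (i - j))
      (by simpa using hw)
    refine ⟨fun k => g (i - k), fun k => ?_, fun k => ?_, fun k => ?_, fun k => ?_⟩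
    · have := h1 (i - (k + 1))
      rw [show i - (k + 1) + 1 = i - k by abel] at this
      exact this.symm
    · simpa using h2 (i - k)
    · have := h3 (i - k)
      simp only [ringParity] at this ⊢
      rwa [show i - k + 1 = i - (k - 1) by abel, show i - k - 1 = i - (k + 1) by abel,
        sub_sub_cancel, add_comm (ltInd (g (i - (k + 1))) _)] at this
    · simpa [sub_eq_zero, eq_comm] using h4 (i - k)

/-- If `i` has a suitable neighbour on the ring ranked by `w`, then an adjacent ring all of whose
vertices must have in-degree parity `c` can be ranked compatibly. -/
theorem exists_pass (hn : 3 ≤ n) (hodd : Odd n) {c : ZMod 2} {w : Fin n → ℚ} {i : Fin n}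
    (hw : HasNeighbor c w i) :
    ∃ g : Fin n → ℚ, (∀ k, g k ≠ g (k + 1)) ∧ (∀ k, g k ≠ w k) ∧
      (∀ k, ringParity g k + ltInd (w k) (g k) = c) ∧
      ∀ k, ltInd (g k) (w k) = 1 + c + if k = i then 1 else 0 := by
  rcases ZMod.two_eq_zero_or_one c with rfl | rfl
  · simpa using exists_pass_zero hn hodd (by simpa [HasNeighbor] using hw)
  · obtain ⟨g, h1, h2, h3, h4⟩ := exists_pass_zero hn hodd (w := fun k => -w k) (i := i)
      (by simpa [HasNeighbor] using hw)
    have h5 : ∀ k, -g k ≠ w k := fun k h => h2 k (by rw [← h, neg_neg])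
    have h6 : ∀ k, ltInd (w k) (-g k) = 1 + if k = i then 1 else 0 := fun k => by
      rw [← h4 k, ← ltInd_neg (-w k) (g k), neg_neg]
    refine ⟨fun k => -g k, fun k => by simpa using h1 k, h5, fun k => ?_, fun k => ?_⟩
    · have h7 := h3 k
      rw [ltInd_swap (h2 k), h4] at h7
      rw [ringParity_neg h1, h6]
      revert h7
      generalize ringParity g k = x
      generalize (if k = i then (1 : ZMod 2) else 0) = y
      revert x y; decide
    · rw [ltInd_swap (h5 k).symm, h6, ← add_assoc]

/-- A ranking of the ring with lowest vertex `0`, highest vertex `1`, and all others monotone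
in between. -/
def arcRank (k : Fin n) : ℚ := if k.val = 0 then 0 else (n - k.val : ℕ)

theorem arcRank_zero : arcRank (0 : Fin n) = 0 := by simp [arcRank]

theorem arcRank_nonneg {n : ℕ} (k : Fin n) : 0 ≤ arcRank k := by
  unfold arcRank; split_ifs <;> positivity

theorem arcRank_lt {n : ℕ} (k : Fin n) : arcRank k < n := by
  have := k.isLt
  unfold arcRank; split_ifs <;> norm_cast <;> omega

theorem arcRank_pos {k : Fin n} (hk : k ≠ 0) : 0 < arcRank k := by
  have := k.isLt
  have h0 : k.val ≠ 0 := by simpa using hk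
  unfold arcRank; rw [if_neg h0]; norm_cast; omega

theorem Fin.val_one_of_three_le (hn : 3 ≤ n) : (1 : Fin n).val = 1 := by
  rw [Fin.val_one', Nat.mod_eq_of_lt (by omega)]

theorem arcRank_lt_one (hn : 3 ≤ n) {k : Fin n} (hk : k ≠ 1) : arcRank k < arcRank (1 : Fin n) := by
  have := k.isLt
  have h1 : k.val ≠ 1 := fun h => hk (Fin.ext (by rw [h, Fin.val_one_of_three_le hn]))
  unfold arcRank
  rw [Fin.val_one_of_three_le hn]
  split_ifs <;> norm_cast <;> omega

theorem arcRank_ne (hn : 3 ≤ n) (k : Fin n) : arcRank k ≠ arcRank (k + 1) := by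
  have := k.isLt
  unfold arcRank
  rw [Fin.val_add_one_cyclic hn]
  split_ifs <;> norm_cast <;> omega

theorem arcRank_succ_lt (hn : 3 ≤ n) {k : Fin n} (hk : k ≠ 0) : arcRank (k + 1) < arcRank k := by
  have := k.isLt
  have h0 : k.val ≠ 0 := by simpa using hk
  unfold arcRank
  rw [Fin.val_add_one_cyclic hn]
  split_ifs <;> norm_cast <;> omega

theorem ringParity_arcRank (hn : 3 ≤ n) (k : Fin n) :
    ringParity arcRank k = 1 + (if k = 0 then 1 else 0) + if k = 1 then 1 else 0 := by
  have h10 : (1 : Fin n) ≠ 0 := fun h => by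
    have := congrArg Fin.val h
    rw [Fin.val_one_of_three_le hn] at this
    simp at this
  have hs : ∀ k : Fin n, k + 1 ≠ k := fun k h => h10 (by simpa using h)
  have hp : ∀ k : Fin n, k - 1 ≠ k := fun k h => hs (k - 1) (by rw [sub_add_cancel]; exact h.symm)
  unfold ringParity
  by_cases h0 : k = 0
  · subst h0
    rw [ltInd_of_le, ltInd_of_le, if_pos rfl, if_neg h10.symm]
    · decide
    · exact arcRank_zero.le.trans (arcRank_nonneg _)
    · exact arcRank_zero.le.trans (arcRank_nonneg _)
  · by_cases h1 : k = 1
    · subst h1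
      rw [ltInd_of_lt (arcRank_lt_one hn (hp 1)), ltInd_of_lt (arcRank_lt_one hn (hs 1)),
        if_neg h10, if_pos rfl]
      decide
    · have h2 := arcRank_succ_lt hn (k := k - 1) (by simpa [sub_eq_zero] using h1)
      rw [sub_add_cancel] at h2
      rw [ltInd_of_le h2.le, ltInd_of_lt (arcRank_succ_lt hn h0), if_neg h0, if_neg h1]
      decide

end Ring

section Cylinder

variable {n : ℕ} [NeZero n]

/-- Ranks `f r k` of the vertices of `C_n □ P_q` (row `r < q`, column `k`) separating adjacent
vertices and such that the orientation towards higher rank has in-degree parities `T`. -/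
structure IsRanking (q : ℕ) (f : ℕ → Fin n → ℚ) (T : ℕ → Fin n → ZMod 2) : Prop where
  ring_ne : ∀ r < q, ∀ k, f r k ≠ f r (k + 1)
  spoke_ne : ∀ r, r + 1 < q → ∀ k, f r k ≠ f (r + 1) k
  parity : ∀ r < q, ∀ k, ringParity (f r) k + (if r = 0 then 0 else ltInd (f (r - 1) k) (f r k)) +
    (if r + 1 < q then ltInd (f (r + 1) k) (f r k) else 0) = T r k

/-- Prepend a term to a sequence. -/
def seqCons {α : Type*} (x : α) (s : ℕ → α) : ℕ → α
  | 0 => x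
  | r + 1 => s r

theorem IsRanking.cons {q : ℕ} {f : ℕ → Fin n → ℚ} {T : ℕ → Fin n → ZMod 2} {g : Fin n → ℚ}
    {A : Fin n → ZMod 2}
    (h : IsRanking q f (seqCons (fun k => T 0 k + ltInd (g k) (f 0 k)) fun r => T (r + 1)))
    (hg : ∀ k, g k ≠ g (k + 1)) (hgf : 0 < q → ∀ k, g k ≠ f 0 k)
    (hA : ∀ k, ringParity g k + (if 0 < q then ltInd (f 0 k) (g k) else 0) = A k) :
    IsRanking (q + 1) (seqCons g f) (seqCons A T) where
  ring_ne := fun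
    | 0, _, k => hg k
    | r + 1, hr, k => h.ring_ne r (by omega) k
  spoke_ne := fun
    | 0, hr, k => hgf (by omega) k
    | r + 1, hr, k => h.spoke_ne r (by omega) k
  parity := fun
    | 0, _, k => by simpa [seqCons] using hA k
    | 1, hr, k => by
      have := h.parity 0 (by omega) k
      simp only [seqCons, if_true] at this ⊢
      rw [if_neg one_ne_zero, Nat.sub_self]
      simp only [add_lt_add_iff_right, zero_add] at this ⊢
      have h2 : ∀ x y z u : ZMod 2, x + 0 + y = z + u → x + u + y = z := by decide
      exact h2 _ _ _ _ this
    | r + 2, hr, k => by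
      have := h.parity (r + 1) (by omega) k
      simpa [seqCons] using this

theorem IsRanking.reflect {q : ℕ} {f : ℕ → Fin n → ℚ} {T : ℕ → Fin n → ZMod 2}
    (h : IsRanking q f T) : IsRanking q (fun r => f (q - 1 - r)) (fun r => T (q - 1 - r)) where
  ring_ne r hr k := h.ring_ne _ (by omega) k
  spoke_ne r hr k := by
    have := h.spoke_ne (q - 1 - (r + 1)) (by omega) k
    rw [show q - 1 - (r + 1) + 1 = q - 1 - r by omega] at this
    exact this.symm
  parity r hr k := by
    have := h.parity (q - 1 - r) (by omega) k
    rw [← this, add_right_comm, add_assoc, add_assoc]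
    congr 2
    · by_cases h1 : r + 1 < q
      · rw [if_pos h1, if_neg (by omega), show q - 1 - r - 1 = q - 1 - (r + 1) by omega]
      · rw [if_neg h1, if_pos (by omega)]
    · by_cases h1 : r = 0
      · rw [if_pos h1, if_neg (by omega)]
      · rw [if_neg h1, if_pos (by omega), show q - 1 - r + 1 = q - 1 - (r - 1) by omega]

/-- Some ranking of `C_n □ P_q` realises the in-degree parities `T`. -/
def HasRanking (q : ℕ) (T : ℕ → Fin n → ZMod 2) : Prop := ∃ f, IsRanking q f T

theorem IsRanking.congr {q : ℕ} {f : ℕ → Fin n → ℚ} {T T' : ℕ → Fin n → ZMod 2}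
    (h : IsRanking q f T) (hT : ∀ r < q, T r = T' r) : IsRanking q f T' :=
  ⟨h.ring_ne, h.spoke_ne, fun r hr k => by rw [← hT r hr, h.parity r hr k]⟩

theorem HasRanking.congr {q : ℕ} {T T' : ℕ → Fin n → ZMod 2}
    (h : HasRanking q T) (hT : ∀ r < q, T r = T' r) : HasRanking q T' :=
  h.imp fun _ hf => hf.congr hT

theorem HasRanking.of_reflect {q : ℕ} {T : ℕ → Fin n → ZMod 2}
    (h : HasRanking q fun r => T (q - 1 - r)) : HasRanking q T := by
  obtain ⟨f, hf⟩ := h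
  exact ⟨_, hf.reflect.congr fun r hr => by rw [show q - 1 - (q - 1 - r) = r by omega]⟩

/-- The parities `T` with `σ` added to all entries of the first row. -/
def addFirst (σ : ZMod 2) (T : ℕ → Fin n → ZMod 2) : ℕ → Fin n → ZMod 2 :=
  seqCons (fun k => T 0 k + σ) fun r => T (r + 1)

theorem ZMod.eq_zero_of_ne_one {a : ZMod 2} (h : a ≠ 1) : a = 0 := by
  revert a; decide

theorem ZMod.eq_one_of_ne_zero {a : ZMod 2} (h : a ≠ 0) : a = 1 := by
  revert a; decide

theorem natCast_eq_one_of_odd {n : ℕ} (hodd : Odd n) : (n : ZMod 2) = 1 :=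
  (ZMod.natCast_eq_one_iff_odd).2 hodd

theorem IsRanking.exists_cons (hn : 3 ≤ n) (hodd : Odd n) {q : ℕ} {f : ℕ → Fin n → ℚ}
    {T : ℕ → Fin n → ZMod 2} {A : Fin n → ZMod 2} (hA0 : ∃ k, A k = 0) (hA1 : ∃ k, A k = 1)
    (hq : q = 0 → ∑ k, A k = 1) (h : IsRanking q f (addFirst (∑ k, A k) T)) (c : ZMod 2)
    (i : Fin n) :
    ∃ g, HasNeighbor c g i ∧ IsRanking (q + 1) (seqCons g f) (seqCons A T) := by
  obtain ⟨z, hz⟩ := hA0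
  obtain ⟨u, hu⟩ := hA1
  have hsub : ∀ (g : Fin n → ℚ) (a : ℚ), HasNeighbor c g i → HasNeighbor c (fun k => g k + a) i :=
    fun g a h => by simpa [HasNeighbor] using h
  rcases ZMod.two_eq_zero_or_one (∑ k, A k) with hS | hS
  · have hq0 : 0 < q := Nat.pos_of_ne_zero fun h => by
      have := hq h; rw [hS] at this; exact absurd this (by decide)
    obtain ⟨g, hg, hp, hi⟩ := exists_ring_hasNeighbor hn (A := fun k => A k + 1) (z := u)
      (by simp [Finset.sum_add_distrib, hS]) (by rw [hu]; decide) c i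
    obtain ⟨L, hL⟩ := exists_forall_lt fun k => g k - f 0 k
    have hlt : ∀ k, f 0 k < g k + -L := fun k => by have := hL k; linarith
    refine ⟨fun k => g k + -L, hsub g _ hi, ?_⟩
    refine IsRanking.cons ?_ (fun k => by simpa using hg k) (fun _ k => (hlt k).ne') fun k => ?_
    · refine h.congr fun r _ => ?_
      cases r with
      | zero => funext k; simp only [addFirst, seqCons]; rw [hS, ltInd_of_le (hlt k).le]
      | succ r => rfl
    · rw [ringParity_add, hp, if_pos hq0, ltInd_of_lt (hlt k), add_assoc]
      exact add_zero _
  · obtain ⟨g, hg, hp, hi⟩ := exists_ring_hasNeighbor hn (A := A) (z := z)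
      (by rw [hS, natCast_eq_one_of_odd hodd]) hz c i
    obtain ⟨L, hL⟩ := exists_forall_lt fun k => f 0 k - g k
    have hlt : ∀ k, g k + L < f 0 k := fun k => by have := hL k; linarith
    refine ⟨fun k => g k + L, hsub g _ hi, ?_⟩
    refine IsRanking.cons ?_ (fun k => by simpa using hg k) (fun _ k => (hlt k).ne) fun k => ?_
    · refine h.congr fun r _ => ?_
      cases r with
      | zero => funext k; simp only [addFirst, seqCons]; rw [hS, ltInd_of_lt (hlt k)]
      | succ r => rfl
    · rw [ringParity_add, hp, ltInd_of_le (hlt k).le, ite_self, add_zero]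

theorem hasRanking_zero (T : ℕ → Fin n → ZMod 2) : HasRanking 0 T :=
  ⟨fun _ _ => 0, fun _ h => absurd h (by omega), fun _ h => absurd h (by omega),
    fun _ h => absurd h (by omega)⟩

/-- A row with all entries equal. -/
def IsConst (A : Fin n → ZMod 2) : Prop := ∃ c, ∀ k, A k = c

theorem exists_of_not_isConst {n : ℕ} {A : Fin n → ZMod 2} (h : ¬ IsConst A) :
    (∃ k, A k = 0) ∧ ∃ k, A k = 1 := by
  constructor
  · by_contra! h1
    exact h ⟨1, fun k => ZMod.eq_one_of_ne_zero (h1 k)⟩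
  · by_contra! h1
    exact h ⟨0, fun k => ZMod.eq_zero_of_ne_one (h1 k)⟩

theorem isConst_add {n : ℕ} {A : Fin n → ZMod 2} {c : ZMod 2} :
    IsConst (fun k => A k + c) ↔ IsConst A :=
  ⟨fun ⟨d, h⟩ => ⟨d - c, fun k => eq_sub_of_add_eq (h k)⟩,
    fun ⟨d, h⟩ => ⟨d + c, fun k => congrArg (· + c) (h k)⟩⟩

theorem HasRanking.of_not_isConst (hn : 3 ≤ n) (hodd : Odd n) {q : ℕ} {T : ℕ → Fin n → ZMod 2}
    (h0 : ¬ IsConst (T 0)) (hq : q = 0 → ∑ k, T 0 k = 1)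
    (h : HasRanking q (addFirst (∑ k, T 0 k) fun r => T (r + 1))) : HasRanking (q + 1) T := by
  obtain ⟨f, hf⟩ := h
  obtain ⟨hA0, hA1⟩ := exists_of_not_isConst h0
  obtain ⟨g, -, hg⟩ := hf.exists_cons hn hodd hA0 hA1 hq 0 0
  exact ⟨_, hg.congr fun r _ => by cases r <;> rfl⟩

theorem exists_not_isConst_add_single {n : ℕ} (hn : 3 ≤ n) (A : Fin n → ZMod 2) :
    ∃ i, ¬ IsConst fun k => A k + if k = i then 1 else 0 := by
  by_contra! h
  obtain ⟨c, hc⟩ := h ⟨0, by omega⟩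
  obtain ⟨d, hd⟩ := h ⟨1, by omega⟩
  have c0 := hc ⟨0, by omega⟩
  have c1 := hc ⟨1, by omega⟩
  have c2 := hc ⟨2, by omega⟩
  have d0 := hd ⟨0, by omega⟩
  have d2 := hd ⟨2, by omega⟩
  simp only [Fin.mk.injEq, OfNat.ofNat_ne_zero, OfNat.ofNat_ne_one, one_ne_zero, zero_ne_one,
    if_true, if_false, add_zero] at c0 c1 c2 d0 d2
  rw [d0, ← d2, c2] at c0
  exact absurd c0 (by simp)

theorem HasRanking.of_isConst (hn : 3 ≤ n) (hodd : Odd n) {q : ℕ} {T : ℕ → Fin n → ZMod 2}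
    {c : ZMod 2} (h0 : ∀ k, T 0 k = c) (hq : q = 0 → c + ∑ k, T 1 k = 1)
    (h : HasRanking q (addFirst (c + ∑ k, T 1 k) fun r => T (r + 2))) : HasRanking (q + 2) T := by
  obtain ⟨f, hf⟩ := h
  obtain ⟨i, hi⟩ := exists_not_isConst_add_single hn fun k => T 1 k + (1 + c)
  obtain ⟨hA0, hA1⟩ := exists_of_not_isConst hi
  have hsum : ∑ k, (T 1 k + (1 + c) + if k = i then 1 else 0) = c + ∑ k, T 1 k := by
    simp only [Finset.sum_add_distrib, Finset.sum_const, Finset.card_univ, Fintype.card_fin,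
      nsmul_eq_mul, natCast_eq_one_of_odd hodd, Finset.sum_ite_eq', Finset.mem_univ, if_true]
    have aux : ∀ x c : ZMod 2, x + (1 * 1 + 1 * c) + 1 = c + x := by decide
    exact aux _ _
  rw [← hsum] at hq hf
  obtain ⟨w, hw, hwf⟩ := hf.exists_cons hn hodd hA0 hA1 hq c i
  obtain ⟨v, h1, h2, h3, h4⟩ := exists_pass hn hodd hw
  have := IsRanking.cons (T := fun r => T (r + 1)) (A := T 0) (hwf.congr fun r _ => ?_) h1
    (fun _ => h2) fun k => ?_
  · exact ⟨_, this.congr fun r _ => by cases r <;> rfl⟩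
  · cases r with
    | zero => funext k; simp only [seqCons]; rw [h4]; exact add_assoc _ _ _
    | succ r => rfl
  · rw [if_pos (by omega), h0]; exact h3 k

theorem HasNeighbor.arcRank_zero (hn : 3 ≤ n) : HasNeighbor 0 arcRank (0 : Fin n) := by
  have h10 : (0 : Fin n) + 1 ≠ 0 := fun h => by
    have := congrArg Fin.val h
    rw [zero_add, Fin.val_one_of_three_le hn] at this
    simp at this
  rw [HasNeighbor, if_pos rfl, _root_.arcRank_zero]
  exact Or.inl (arcRank_pos h10)

theorem HasNeighbor.arcRank_one (hn : 3 ≤ n) : HasNeighbor 1 arcRank (1 : Fin n) := by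
  have h10 : (1 : Fin n) ≠ 0 := fun h => by
    have := congrArg Fin.val h
    rw [Fin.val_one_of_three_le hn] at this
    simp at this
  rw [HasNeighbor, if_neg (by decide)]
  exact Or.inl (arcRank_succ_lt hn h10)

theorem HasRanking.three_of_ring (hn : 3 ≤ n) (hodd : Odd n) {T : ℕ → Fin n → ZMod 2}
    {c d : ZMod 2} (hc : ∀ k, T 0 k = c) (hd : ∀ k, T 2 k = d) {g : Fin n → ℚ} {i j : Fin n}
    (hg : ∀ k, g k ≠ g (k + 1)) (hi : HasNeighbor c g i) (hj : HasNeighbor d g j)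
    (hp : ∀ k, ringParity g k =
      T 1 k + (c + d) + ((if k = i then 1 else 0) + if k = j then 1 else 0)) :
    HasRanking 3 T := by
  obtain ⟨v, v1, v2, v3, v4⟩ := exists_pass hn hodd hi
  obtain ⟨z, z1, z2, z3, z4⟩ := exists_pass hn hodd hj
  refine ⟨fun | 0 => v | 1 => g | _ => z, ?_, ?_, ?_⟩
  · intro r hr
    interval_cases r
    exacts [v1, hg, z1]
  · intro r hr k
    obtain hr : r < 2 := by omega
    interval_cases r
    exacts [v2 k, (z2 k).symm]
  · intro r hr k
    interval_cases r
    · simpa [hc] using v3 k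
    · simp only [one_ne_zero, if_false, Nat.sub_self, Nat.reduceAdd, Nat.reduceLT, if_true]
      rw [v4, z4, hp]
      have aux : ∀ x c d y z : ZMod 2,
          x + (c + d) + (y + z) + (1 + c + y) + (1 + d + z) = x := by decide
      exact aux _ _ _ _ _
    · simpa [hd] using z3 k

theorem HasRanking.three (hn : 3 ≤ n) (hodd : Odd n) {T : ℕ → Fin n → ZMod 2} {c d : ZMod 2}
    (hc : ∀ k, T 0 k = c) (hd : ∀ k, T 2 k = d) (hsum : ∑ k, T 1 k = 1 + c + d)
    (h : c = d → ∃ k, T 1 k = 0) : HasRanking 3 T := by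
  have hxx : ∀ x : ZMod 2, x + x = 0 := by decide
  by_cases hcd : c = d
  · subst hcd
    obtain ⟨z, hz⟩ := h rfl
    obtain ⟨g, h1, h2, h3⟩ := exists_ring_hasNeighbor hn
      (by rw [hsum, natCast_eq_one_of_odd hodd, add_assoc, hxx, add_zero]) hz c 0
    exact three_of_ring hn hodd hc hd h1 h3 h3 fun k => by rw [h2, hxx, hxx, add_zero, add_zero]
  · have hcd' : c + d = 1 := (by decide : ∀ c d : ZMod 2, c ≠ d → c + d = 1) c d hcd
    rw [add_assoc, hcd', hxx] at hsum
    by_cases hT : ∃ u, T 1 u = 1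
    · obtain ⟨u, hu⟩ := hT
      have hz : ∃ z, T 1 z = 0 := by
        by_contra! h0
        rw [Finset.sum_congr rfl fun k _ => ZMod.eq_one_of_ne_zero (h0 k)] at hsum
        simp [natCast_eq_one_of_odd hodd] at hsum
      obtain ⟨z, hz⟩ := hz
      obtain ⟨g, h1, h2⟩ := exists_ring hn (A := fun k => T 1 k + 1) (z := u)
        (by simp [Finset.sum_add_distrib, hsum]) (by rw [hu]; decide)
      have h3 : ringParity g z = 1 := by rw [h2, hz, zero_add]
      exact three_of_ring hn hodd hc hd h1 (hasNeighbor_of_parity_one h1 h3 c)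
        (hasNeighbor_of_parity_one h1 h3 d) fun k => by rw [h2, hxx, hcd', add_zero]
    · have hT0 : ∀ k, T 1 k = 0 := fun k => ZMod.eq_zero_of_ne_one fun h => hT ⟨k, h⟩
      rcases ZMod.two_eq_zero_or_one c with rfl | rfl
      · rw [zero_add] at hcd'
        subst hcd'
        exact three_of_ring hn hodd hc hd (arcRank_ne hn) (HasNeighbor.arcRank_zero hn)
          (HasNeighbor.arcRank_one hn) fun k => by
            rw [ringParity_arcRank hn, hT0, zero_add, zero_add, add_assoc]
      · obtain rfl : d = 0 := by simpa using hcd'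
        exact three_of_ring hn hodd hc hd (arcRank_ne hn) (HasNeighbor.arcRank_one hn)
          (HasNeighbor.arcRank_zero hn) fun k => by
            rw [ringParity_arcRank hn, hT0, zero_add, add_zero, add_assoc,
              add_comm (if k = 0 then (1 : ZMod 2) else 0)]

theorem HasRanking.five (hn : 3 ≤ n) (hodd : Odd n) {T : ℕ → Fin n → ZMod 2}
    (h0 : ∀ k, T 0 k = 0) (h1 : ∀ k, T 1 k = 1) (h2 : ∀ k, T 2 k = 0) (h3 : ∀ k, T 3 k = 1)
    (h4 : ∀ k, T 4 k = 1) : HasRanking 5 T := by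
  have h10 : (1 : Fin n) ≠ 0 := fun h => by
    have := congrArg Fin.val h
    rw [Fin.val_one_of_three_le hn] at this
    simp at this
  have hnpos : (3 : ℚ) ≤ n := by exact_mod_cast hn
  let x : Fin n → ℚ := fun k => if k = 0 then -1 else if k = 1 then 4 * n else n + arcRank k
  let w : Fin n → ℚ := fun k => arcRank k + 2 * n
  have hxlt : ∀ a b, ltInd (x a) (x b) = ltInd (arcRank a) (arcRank b) := fun a b => by
    have : x a < x b ↔ arcRank a < arcRank b := by
      have ha := arcRank_nonneg a
      have hb := arcRank_nonneg b
      have ha' := arcRank_lt a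
      have hb' := arcRank_lt b
      by_cases a0 : a = 0
      · by_cases b0 : b = 0
        · simp [a0, b0]
        · have := arcRank_pos b0
          rw [a0, arcRank_zero]
          refine iff_of_true ?_ this
          simp only [x, if_true, if_neg b0]
          split_ifs <;> linarith
      · have ha0 := arcRank_pos a0
        by_cases b0 : b = 0
        · rw [b0, arcRank_zero]
          refine iff_of_false ?_ ha.not_gt
          simp only [x, if_true, if_neg a0, not_lt]
          split_ifs <;> linarith
        · by_cases a1 : a = 1
          · refine iff_of_false ?_ ?_
            · simp only [x, if_neg a0, if_pos a1, if_neg b0, not_lt]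
              split_ifs <;> linarith
            · by_cases b1 : b = 1
              · rw [a1, b1]; exact lt_irrefl _
              · rw [a1]; exact (arcRank_lt_one hn b1).not_gt
          · by_cases b1 : b = 1
            · refine iff_of_true ?_ (by rw [b1]; exact arcRank_lt_one hn a1)
              simp only [x, if_neg a0, if_pos b1, if_neg b0, if_neg a1]
              linarith
            · simp only [x, if_neg a0, if_neg b0, if_neg a1, if_neg b1, add_lt_add_iff_left]
    simp only [ltInd, this]
  have hxne : ∀ k, x k ≠ x (k + 1) := fun k h => by
    have e1 := hxlt k (k + 1)
    have e2 := hxlt (k + 1) k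
    rw [ltInd_of_le h.ge] at e1
    rw [ltInd_of_le h.le] at e2
    have e3 := ltInd_swap (arcRank_ne hn k)
    rw [← e1, ← e2] at e3
    exact absurd e3 (by decide)
  have hxp : ∀ k, ringParity x k = ringParity arcRank k := fun k => by
    simp only [ringParity, hxlt]
  have hwp : ∀ k, ringParity w k = ringParity arcRank k := fun k => ringParity_add _ _ k
  have hxw : ∀ k, x k ≠ w k ∧ ltInd (x k) (w k) = 1 + if k = 1 then 1 else 0 := fun k => by
    have ha := arcRank_nonneg k
    have ha' := arcRank_lt k
    by_cases k1 : k = 1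
    · have : w k < x k := by simp only [w, x, k1, if_neg h10, if_true] at ha' ⊢; linarith
      rw [ltInd_of_le this.le, if_pos k1]
      exact ⟨this.ne', by decide⟩
    · have : x k < w k := by
        simp only [w, x, if_neg k1]
        split_ifs <;> linarith
      rw [ltInd_of_lt this, if_neg k1]
      exact ⟨this.ne, by decide⟩
  have hyx : ∀ k, arcRank k ≠ x k ∧ ltInd (arcRank k) (x k) = 1 + if k = 0 then 1 else 0 :=
    fun k => by
    have ha := arcRank_nonneg k
    have ha' := arcRank_lt k
    by_cases k0 : k = 0
    · have : x k < arcRank k := by simp only [x, if_pos k0]; linarith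
      rw [ltInd_of_le this.le, if_pos k0]
      exact ⟨this.ne', by decide⟩
    · have : arcRank k < x k := by
        simp only [x, if_neg k0]
        split_ifs <;> linarith
      rw [ltInd_of_lt this, if_neg k0]
      exact ⟨this.ne, by decide⟩
  have hw0 : HasNeighbor 0 w 0 := by simpa [HasNeighbor, w] using HasNeighbor.arcRank_zero hn
  obtain ⟨v, v1, v2, v3, v4⟩ := exists_pass hn hodd hw0
  obtain ⟨z, z1, z2, z3, z4⟩ := exists_pass hn hodd (HasNeighbor.arcRank_one hn)
  refine ⟨fun | 0 => v | 1 => w | 2 => x | 3 => arcRank | _ => z, ?_, ?_, ?_⟩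
  · intro r hr
    interval_cases r
    exacts [v1, fun k => by simpa [w] using arcRank_ne hn k, hxne, arcRank_ne hn, z1]
  · intro r hr k
    obtain hr : r < 4 := by omega
    interval_cases r
    exacts [v2 k, (hxw k).1.symm, (hyx k).1.symm, (z2 k).symm]
  · intro r hr k
    interval_cases r
    · simpa [h0] using v3 k
    · simp only [one_ne_zero, if_false, Nat.sub_self, Nat.reduceAdd, Nat.reduceLT, if_true]
      rw [v4, (hxw k).2, hwp, ringParity_arcRank hn, h1]
      generalize (if k = 0 then (1 : ZMod 2) else 0) = y
      generalize (if k = 1 then (1 : ZMod 2) else 0) = y'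
      revert y y'; decide
    · simp only [OfNat.ofNat_ne_zero, if_false, Nat.reduceSub, Nat.reduceAdd, Nat.reduceLT, if_true]
      rw [ltInd_swap (hxw k).1, (hxw k).2, (hyx k).2, hxp, ringParity_arcRank hn, h2]
      generalize (if k = 0 then (1 : ZMod 2) else 0) = y
      generalize (if k = 1 then (1 : ZMod 2) else 0) = y'
      revert y y'; decide
    · simp only [OfNat.ofNat_ne_zero, if_false, Nat.reduceSub, Nat.reduceAdd, Nat.reduceLT, if_true]
      rw [ltInd_swap (hyx k).1, (hyx k).2, z4, ringParity_arcRank hn, h3]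
      generalize (if k = 0 then (1 : ZMod 2) else 0) = y
      generalize (if k = 1 then (1 : ZMod 2) else 0) = y'
      revert y y'; decide
    · simpa [h4] using z3 k

theorem sum_of_forall_eq {n : ℕ} (hodd : Odd n) {A : Fin n → ZMod 2} {c : ZMod 2}
    (h : ∀ k, A k = c) : ∑ k, A k = c := by
  simp [h, natCast_eq_one_of_odd hodd]

theorem sum_addFirst {n : ℕ} (hodd : Odd n) {q : ℕ} (hq : 0 < q) (σ : ZMod 2)
    (T : ℕ → Fin n → ZMod 2) :
    ∑ r ∈ Finset.range q, ∑ k, addFirst σ T r k = σ + ∑ r ∈ Finset.range q, ∑ k, T r k := by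
  obtain ⟨m, rfl⟩ : ∃ m, q = m + 1 := ⟨q - 1, by omega⟩
  simp only [Finset.sum_range_succ', addFirst, seqCons, Finset.sum_add_distrib,
    sum_of_forall_eq hodd (fun _ => rfl : ∀ _, _ = σ)]
  ring

/-- The necessary conditions for `T` to be realised on `C_n □ P_q` (with `n` odd): the total parity
is odd and, for odd `q`, neither every vertex nor exactly the middle rows lie in `T`. -/
structure Admissible (q : ℕ) (T : ℕ → Fin n → ZMod 2) : Prop where
  sum_eq : ∑ r ∈ Finset.range q, ∑ k, T r k = 1
  exists_zero : Odd q → ∃ r < q, ∃ k, T r k = 0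
  exists_ne : Odd q → ∃ r < q, ∃ k, T r k ≠ if r = 0 ∨ r + 1 = q then 0 else 1

theorem Admissible.reflect {n : ℕ} {q : ℕ} {T : ℕ → Fin n → ZMod 2} (h : Admissible q T) :
    Admissible q fun r => T (q - 1 - r) where
  sum_eq := by rw [← h.sum_eq]; exact Finset.sum_range_reflect (fun r => ∑ k, T r k) q
  exists_zero hq := by
    obtain ⟨r, hr, k, hk⟩ := h.exists_zero hq
    exact ⟨q - 1 - r, by omega, k, by rwa [show q - 1 - (q - 1 - r) = r by omega]⟩
  exists_ne hq := by
    obtain ⟨r, hr, k, hk⟩ := h.exists_ne hq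
    refine ⟨q - 1 - r, by omega, k, ?_⟩
    rw [show q - 1 - (q - 1 - r) = r by omega]
    have : (q - 1 - r = 0 ∨ q - 1 - r + 1 = q) ↔ (r = 0 ∨ r + 1 = q) := by omega
    simpa only [this] using hk

theorem Admissible.exists_ne_of_not_isConst {n : ℕ} {q : ℕ} {T : ℕ → Fin n → ZMod 2} (hq : 0 < q)
    (h : ¬ IsConst (T (q - 1))) :
    (∃ r < q, ∃ k, T r k = 0) ∧ ∃ r < q, ∃ k, T r k ≠ if r = 0 ∨ r + 1 = q then 0 else 1 := by
  obtain ⟨⟨k, hk⟩, l, hl⟩ := exists_of_not_isConst h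
  exact ⟨⟨q - 1, by omega, k, hk⟩, q - 1, by omega, l, by
    rw [if_pos (Or.inr (by omega)), hl]; exact one_ne_zero⟩

/-- Removing a first row with both parities present. -/
theorem Admissible.hasRanking_of_not_isConst (hn : 3 ≤ n) (hodd : Odd n) {q : ℕ}
    {T : ℕ → Fin n → ZMod 2}
    (ih : ∀ T : ℕ → Fin n → ZMod 2, Admissible q T → HasRanking q T)
    (h : Admissible (q + 1) T) (h0 : ¬ IsConst (T 0)) (hlast : Odd q → ¬ IsConst (T q)) :
    HasRanking (q + 1) T := by
  have hsum := h.sum_eq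
  rw [Finset.sum_range_succ'] at hsum
  rcases Nat.eq_zero_or_pos q with rfl | hq
  · exact .of_not_isConst hn hodd h0 (fun _ => by simpa using hsum) (hasRanking_zero _)
  · refine .of_not_isConst hn hodd h0 (by omega) (ih _ ⟨?_, ?_, ?_⟩)
    · rw [sum_addFirst hodd hq, add_comm, hsum]
    all_goals
      intro hqodd
      have h1 : ¬ IsConst (addFirst (∑ k, T 0 k) (fun r => T (r + 1)) (q - 1)) := by
        have h2 := hlast hqodd
        obtain ⟨m, rfl⟩ : ∃ m, q = m + 1 := ⟨q - 1, by omega⟩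
        cases m with
        | zero => exact fun h3 => h2 (isConst_add.1 h3)
        | succ m => exact h2
    · exact (exists_ne_of_not_isConst hq h1).1
    · exact (exists_ne_of_not_isConst hq h1).2

/-- Removing two rows, the first of which is constant. -/
theorem Admissible.hasRanking_or (hn : 3 ≤ n) (hodd : Odd n) {q : ℕ} {T : ℕ → Fin n → ZMod 2}
    (ih : ∀ T : ℕ → Fin n → ZMod 2, Admissible q T → HasRanking q T)
    (h : Admissible (q + 2) T) (h0 : IsConst (T 0)) :
    HasRanking (q + 2) T ∨
      (Odd q ∧ (∀ r, 3 ≤ r → r ≤ q → ∀ k, T r k = 1) ∧ IsConst (T 2)) := by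
  obtain ⟨c, hc⟩ := h0
  have hsum := h.sum_eq
  rw [Finset.sum_range_succ', Finset.sum_range_succ', sum_of_forall_eq hodd hc] at hsum
  rcases Nat.eq_zero_or_pos q with rfl | hq
  · left
    exact .of_isConst hn hodd hc (fun _ => by simpa [add_comm] using hsum) (hasRanking_zero _)
  · by_cases hadm : Admissible q (addFirst (c + ∑ k, T 1 k) fun r => T (r + 2))
    · left
      exact .of_isConst hn hodd hc (by omega) (ih _ hadm)
    · right
      have hS : ∑ r ∈ Finset.range q, ∑ k,
          addFirst (c + ∑ k, T 1 k) (fun r => T (r + 2)) r k = 1 := by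
        rw [sum_addFirst hodd hq, ← hsum]
        ring
      by_cases hqodd : Odd q
      · refine ⟨hqodd, ?_⟩
        by_cases hz : ∃ r < q, ∃ k, addFirst (c + ∑ k, T 1 k) (fun r => T (r + 2)) r k = 0
        · have he : ¬ ∃ r < q, ∃ k, addFirst (c + ∑ k, T 1 k) (fun r => T (r + 2)) r k ≠
              if r = 0 ∨ r + 1 = q then 0 else 1 :=
            fun he => hadm ⟨hS, fun _ => hz, fun _ => he⟩
          push Not at he
          refine ⟨fun r h3 hr k => ?_, isConst_add.1 ⟨0, he 0 hq⟩⟩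
          have := he (r - 2) (by omega) k
          obtain ⟨m, rfl⟩ : ∃ m, r = m + 3 := ⟨r - 3, by omega⟩
          rw [if_neg (by omega)] at this
          exact this
        · push Not at hz
          refine ⟨fun r h3 hr k => ?_,
            isConst_add.1 ⟨1, fun k => ZMod.eq_one_of_ne_zero (hz 0 hq k)⟩⟩
          have := hz (r - 2) (by omega) k
          obtain ⟨m, rfl⟩ : ∃ m, r = m + 3 := ⟨r - 3, by omega⟩
          exact ZMod.eq_one_of_ne_zero this
      · exact absurd ⟨hS, fun h => absurd h hqodd, fun h => absurd h hqodd⟩ hadm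

theorem Admissible.false_of_middle {n : ℕ} (hodd : Odd n) {q : ℕ} {T : ℕ → Fin n → ZMod 2}
    (hq : Odd q) (h3 : 3 ≤ q) (h : Admissible q T) (h0 : IsConst (T 0)) (h1 : IsConst (T (q - 1)))
    (hmid : ∀ r, 1 ≤ r → r + 1 < q → ∀ k, T r k = 1) : False := by
  obtain ⟨c, hc⟩ := h0
  obtain ⟨d, hd⟩ := h1
  obtain ⟨m, rfl⟩ : ∃ m, q = m + 2 := ⟨q - 2, by omega⟩
  have hm : (m : ZMod 2) = 1 := by
    rw [ZMod.natCast_eq_one_iff_odd]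
    rcases hq with ⟨a, ha⟩
    exact ⟨a - 1, by omega⟩
  have hsum := h.sum_eq
  rw [Finset.sum_range_succ, Finset.sum_range_succ', sum_of_forall_eq hodd hc,
    sum_of_forall_eq hodd (show ∀ k, T (m + 1) k = d from hd),
    Finset.sum_congr rfl fun r hr => sum_of_forall_eq hodd
      (hmid (r + 1) (by omega) (by have := Finset.mem_range.1 hr; omega))] at hsum
  simp only [Finset.sum_const, Finset.card_range, nsmul_eq_mul, hm, mul_one] at hsum
  have hcd : c = d := (by decide : ∀ c d : ZMod 2, 1 + c + d = 1 → c = d) c d hsum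
  subst hcd
  rcases ZMod.two_eq_zero_or_one c with rfl | rfl
  · obtain ⟨r, hr, k, hk⟩ := h.exists_ne hq
    apply hk
    split_ifs with hr'
    · rcases hr' with rfl | hr'
      · exact hc k
      · rw [show r = m + 2 - 1 by omega]; exact hd k
    · exact hmid r (by omega) (by omega) k
  · obtain ⟨r, hr, k, hk⟩ := h.exists_zero hq
    have : T r k = 1 := by
      by_cases hr0 : r = 0
      · rw [hr0]; exact hc k
      · by_cases hr1 : r + 1 = m + 2
        · rw [show r = m + 2 - 1 by omega]; exact hd k
        · exact hmid r (by omega) (by omega) k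
    rw [hk] at this
    exact absurd this (by decide)

theorem Admissible.hasRanking_five (hn : 3 ≤ n) (hodd : Odd n) {T : ℕ → Fin n → ZMod 2}
    (h : Admissible 5 T) (h0 : IsConst (T 0)) (h1 : ∀ k, T 1 k = 1) (h2 : IsConst (T 2))
    (h3 : ∀ k, T 3 k = 1) (h4 : IsConst (T 4)) : HasRanking 5 T := by
  by_cases hmid : ∀ k, T 2 k = 1
  · refine (h.false_of_middle hodd (by decide) (by omega) h0 h4 fun r hr hr' => ?_).elim
    obtain hr' : r < 4 := by omega
    interval_cases r
    exacts [h1, hmid, h3]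
  · obtain ⟨a, ha⟩ := h0
    obtain ⟨c, hc⟩ := h2
    obtain ⟨e, he⟩ := h4
    have hc1 : c ≠ 1 := fun hc1 => hmid fun k => (hc k).trans hc1
    obtain rfl := ZMod.eq_zero_of_ne_one hc1
    have hsum := h.sum_eq
    simp only [Finset.sum_range_succ, Finset.sum_range_zero, sum_of_forall_eq hodd ha,
      sum_of_forall_eq hodd h1, sum_of_forall_eq hodd hc, sum_of_forall_eq hodd h3,
      sum_of_forall_eq hodd he] at hsum
    rcases ZMod.two_eq_zero_or_one a with rfl | rfl
    · obtain rfl : e = 1 := by revert hsum; generalize e = x; revert x; decide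
      exact .five hn hodd ha h1 hc h3 he
    · obtain rfl : e = 0 := by revert hsum; generalize e = x; revert x; decide
      exact .of_reflect (.five hn hodd he h3 hc h1 ha)

theorem Admissible.hasRanking (hn : 3 ≤ n) (hodd : Odd n) {q : ℕ} {T : ℕ → Fin n → ZMod 2}
    (h : Admissible q T) : HasRanking q T := by
  induction q using Nat.strong_induction_on generalizing T with
  | _ q ih =>
  rcases Nat.eq_zero_or_pos q with rfl | hpos
  · exact hasRanking_zero T
  by_cases h0 : IsConst (T 0)
  · by_cases hq1 : q = 1
    · subst hq1
      obtain ⟨c, hc⟩ := h0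
      have hsum := h.sum_eq
      simp only [Finset.sum_range_one, sum_of_forall_eq hodd hc] at hsum
      obtain ⟨r, hr, k, hk⟩ := h.exists_zero odd_one
      obtain rfl : r = 0 := by omega
      rw [hc, hsum] at hk
      exact absurd hk (by decide)
    obtain ⟨m, rfl⟩ : ∃ m, q = m + 2 := ⟨q - 2, by omega⟩
    have ihm : ∀ T : ℕ → Fin n → ZMod 2, Admissible m T → HasRanking m T :=
      fun T => ih m (by omega)
    rcases h.hasRanking_or hn hodd ihm h0 with h' | ⟨hm, hr, h2⟩
    · exact h'
    have hmodd : Odd (m + 2) := hm.add_even (by decide)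
    by_cases hl : IsConst (T (m + 1))
    · rcases h.reflect.hasRanking_or hn hodd ihm hl with h' | ⟨-, hr', h2'⟩
      · exact h'.of_reflect
      have hr'' : ∀ r, 1 ≤ r → r + 2 ≤ m → ∀ k, T r k = 1 := fun r h1 h2 k => by
        have := hr' (m + 1 - r) (by omega) (by omega) k
        rwa [show m + 2 - 1 - (m + 1 - r) = r by omega] at this
      obtain ⟨a, rfl⟩ := hm
      rcases (by omega : a = 0 ∨ a = 1 ∨ 2 ≤ a) with rfl | rfl | ha
      · obtain ⟨c, hc⟩ := h0
        obtain ⟨d, hd⟩ := hl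
        have hsum := h.sum_eq
        simp only [mul_zero, zero_add, Nat.reduceAdd, Finset.sum_range_succ,
          Finset.sum_range_zero] at hsum hd
        rw [sum_of_forall_eq hodd hc, sum_of_forall_eq hodd hd] at hsum
        have hx : ∑ k, T 1 k = 1 + c + d :=
          (by decide : ∀ x c d : ZMod 2, c + x + d = 1 → x = 1 + c + d) _ _ _ hsum
        refine .three hn hodd hc hd hx fun hcd => ?_
        by_contra! hne
        refine h.false_of_middle hodd hmodd (by omega) ⟨c, hc⟩ ⟨d, hd⟩ fun r h1 h2 k => ?_
        obtain rfl : r = 1 := by omega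
        exact ZMod.eq_one_of_ne_zero (hne k)
      · exact h.hasRanking_five hn hodd h0 (hr'' 1 le_rfl (by omega)) h2 (hr 3 le_rfl (by omega)) hl
      · refine (h.false_of_middle hodd hmodd (by omega) h0 hl fun r h1 h2 => ?_).elim
        rcases (by omega : 3 ≤ r ∨ r + 2 ≤ 2 * a + 1) with h3 | h3
        · exact hr r h3 (by omega)
        · exact hr'' r h1 h3
    · refine .of_reflect (h.reflect.hasRanking_of_not_isConst hn hodd
        (fun T => ih (m + 1) (by omega)) hl fun h1 => ?_)
      exact absurd hmodd (Nat.not_odd_iff_even.2 h1.add_one)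
  · obtain ⟨m, rfl⟩ : ∃ m, q = m + 1 := ⟨q - 1, by omega⟩
    have ihm : ∀ T : ℕ → Fin n → ZMod 2, Admissible m T → HasRanking m T :=
      fun T => ih m (by omega)
    by_cases hm : Odd m ∧ IsConst (T m)
    · obtain ⟨a, rfl⟩ : ∃ a, m = a + 1 := ⟨m - 1, by have := hm.1.pos; omega⟩
      rcases h.reflect.hasRanking_or hn hodd (fun T => ih a (by omega)) hm.2 with h' | ⟨ha, -⟩
      · exact h'.of_reflect
      · exact absurd hm.1 (by simpa using ha.add_one)
    · exact h.hasRanking_of_not_isConst hn hodd ihm h0 fun h1 h2 => hm ⟨h1, h2⟩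

theorem cylinder_adj_iff (hn : 3 ≤ n) {q : ℕ} (u v : Fin n × Fin q) :
    (cycleGraph n □ pathGraph q).Adj u v ↔
      ((u.1 = v.1 - 1 ∨ u.1 = v.1 + 1) ∧ u.2.val = v.2.val) ∨
        (u.1 = v.1 ∧ (u.2.val + 1 = v.2.val ∨ u.2.val = v.2.val + 1)) := by
  have h1 : ∀ a b : Fin n, (a - b).val = 1 ↔ a = b + 1 := fun a b => by
    rw [← Fin.val_one_of_three_le hn, ← Fin.ext_iff, sub_eq_iff_eq_add']
  rw [boxProd_adj, cycleGraph_adj', pathGraph_adj, h1, h1, ← Fin.ext_iff,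
    eq_comm (a := v.2.val + 1),
    eq_sub_iff_add_eq, eq_comm (a := v.1), or_comm (a := u.1 = v.1 + 1)]
  tauto

theorem sum_ite_vertex {n q : ℕ} (P : Fin n → ℕ → Prop) [∀ a b, Decidable (P a b)]
    (a : Fin n) (b : ℕ) :
    ∑ u : Fin n × Fin q, (if u.1 = a ∧ u.2.val = b ∧ P a b then 1 else 0) =
      if b < q ∧ P a b then 1 else 0 := by
  by_cases hP : P a b
  · by_cases hb : b < q
    · rw [if_pos ⟨hb, hP⟩, Finset.sum_eq_single (a, ⟨b, hb⟩)]
      · simp [hP]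
      · intro u _ hu
        exact if_neg fun h => hu (Prod.ext h.1 (Fin.ext h.2.1))
      · simp
    · rw [if_neg fun h => hb h.1]
      exact Finset.sum_eq_zero fun u _ => if_neg <| by
        rintro ⟨-, h, -⟩
        exact hb (h ▸ u.2.isLt)
  · simp [hP]

theorem ncard_cylinder_adj (hn : 3 ≤ n) {q : ℕ} (P : Fin n → ℕ → Prop)
    [∀ a b, Decidable (P a b)] (v : Fin n × Fin q) :
    Set.ncard {u | (cycleGraph n □ pathGraph q).Adj u v ∧ P u.1 u.2.val} =
      (if P (v.1 - 1) v.2.val then 1 else 0) + (if P (v.1 + 1) v.2.val then 1 else 0) +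
      (if 0 < v.2.val ∧ P v.1 (v.2.val - 1) then 1 else 0) +
      (if v.2.val + 1 < q ∧ P v.1 (v.2.val + 1) then 1 else 0) := by
  classical
  obtain ⟨k, r⟩ := v
  have hr := r.isLt
  have hne : k - 1 ≠ k + 1 := fun h => by
    have h1 := congrArg Fin.val h
    have hk := k.isLt
    rw [Fin.val_add_one_cyclic hn, Fin.val_sub_one_cyclic hn] at h1
    split_ifs at h1 <;> omega
  have hdown : (if 0 < r.val ∧ P k (r.val - 1) then 1 else 0) =
      if (if 0 < r.val then r.val - 1 else q) < q ∧ P k (if 0 < r.val then r.val - 1 else q)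
        then 1 else 0 := by
    by_cases h : 0 < r.val
    · simp [h, show r.val - 1 < q by omega]
    · simp [h]
  rw [Set.ncard_eq_toFinset_card', Set.toFinset_ofPred, Finset.card_filter]
  simp only
  rw [hdown]
  have e1 := sum_ite_vertex (q := q) P (k - 1) r.val
  have e2 := sum_ite_vertex (q := q) P (k + 1) r.val
  simp only [hr, true_and] at e1 e2
  rw [← e1, ← e2, ← sum_ite_vertex, ← sum_ite_vertex, ← Finset.sum_add_distrib,
    ← Finset.sum_add_distrib, ← Finset.sum_add_distrib]
  refine Finset.sum_congr rfl fun u _ => ?_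
  obtain ⟨a, b⟩ := u
  have hb := b.isLt
  rw [cylinder_adj_iff hn]
  simp only
  have h3 : b.val = (if 0 < r.val then r.val - 1 else q) ↔ b.val + 1 = r.val := by
    split_ifs <;> omega
  have h4 : ∀ x y, (a = x ∧ b.val = y ∧ P x y) ↔ (a = x ∧ b.val = y ∧ P a b.val) := by
    rintro x y
    constructor <;> (rintro ⟨rfl, rfl, h⟩; exact ⟨rfl, rfl, h⟩)
  simp only [h4 (k - 1), h4 (k + 1), h4 k]
  simp only [h3]
  by_cases hP : P a b.val
  · simp only [hP, and_true]
    by_cases hb' : b.val = r.val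
    · have n1 : ¬ b.val + 1 = r.val := by omega
      have n2 : ¬ b.val = r.val + 1 := by omega
      have n3 : ¬ r.val = r.val + 1 := by omega
      simp only [hb', n3, and_true, and_false, or_false, if_false, add_zero, Nat.succ_ne_self]
      by_cases ha : a = k - 1
      · have := ha ▸ hne
        simp [ha, hne]
      · simp [ha]
    · by_cases n1 : b.val + 1 = r.val
      · have n2 : ¬ b.val = r.val + 1 := by omega
        simp [hb', n1, n2]
      · simp [hb', n1]
  · simp [hP]

/-- The rows of the indicator function of a set of vertices of the cylinder, extended by zero. -/
noncomputable def rowIndicator {n q : ℕ} (T : Set (Fin n × Fin q)) (r : ℕ) (k : Fin n) : ZMod 2 :=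
  open Classical in if ∃ h : r < q, (k, (⟨r, h⟩ : Fin q)) ∈ T then 1 else 0

open Classical in
theorem rowIndicator_apply {n q : ℕ} (T : Set (Fin n × Fin q)) (v : Fin n × Fin q) :
    rowIndicator T v.2.val v.1 = if v ∈ T then 1 else 0 := by
  simp [rowIndicator]

theorem sum_rowIndicator {n q : ℕ} (T : Set (Fin n × Fin q)) :
    ∑ r ∈ Finset.range q, ∑ k, rowIndicator T r k = T.ncard := by
  classical
  rw [Finset.sum_range fun r => ∑ k, rowIndicator T r k, Finset.sum_comm,
    ← Fintype.sum_prod_type' fun (k : Fin n) (r : Fin q) => rowIndicator T r.val k,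
    Set.ncard_eq_toFinset_card', Finset.card_eq_sum_ones, Nat.cast_sum]
  simp only [rowIndicator_apply]
  simp

theorem IsRanking.ne_of_adj (hn : 3 ≤ n) {q : ℕ} {f : ℕ → Fin n → ℚ} {T : ℕ → Fin n → ZMod 2}
    (hf : IsRanking q f T) {u v : Fin n × Fin q} (h : (cycleGraph n □ pathGraph q).Adj u v) :
    f u.2.val u.1 ≠ f v.2.val v.1 := by
  obtain ⟨a, r⟩ := u
  obtain ⟨b, s⟩ := v
  rw [cylinder_adj_iff hn] at h
  simp only at h ⊢
  rcases h with ⟨rfl | rfl, h⟩ | ⟨rfl, h | h⟩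
  · simpa [h] using hf.ring_ne s s.isLt (b - 1)
  · simpa [h] using (hf.ring_ne s s.isLt b).symm
  · rw [← h]
    exact hf.spoke_ne r (h ▸ s.isLt) a
  · rw [h]
    exact (hf.spoke_ne s (h ▸ r.isLt) a).symm

theorem HasRanking.hasAcyclicTOddOrientation (hn : 3 ≤ n) {q : ℕ} {T : Set (Fin n × Fin q)}
    (h : HasRanking q (rowIndicator T)) :
    HasAcyclicTOddOrientation (cycleGraph n □ pathGraph q) T := by
  classical
  obtain ⟨f, hf⟩ := h
  refine ⟨⟨fun u v => (cycleGraph n □ pathGraph q).Adj u v ∧ f u.2.val u.1 < f v.2.val v.1,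
    fun u v h => h.1, fun u v h => ?_⟩, ?_, fun v => ?_⟩
  · have hne := hf.ne_of_adj hn h
    simp only [h, h.symm, true_and, not_lt]
    exact ⟨le_of_lt, fun h' => lt_of_le_of_ne h' hne⟩
  · have hlt : ∀ u v : Fin n × Fin q, Relation.TransGen (fun u v =>
        (cycleGraph n □ pathGraph q).Adj u v ∧ f u.2.val u.1 < f v.2.val v.1) u v →
        f u.2.val u.1 < f v.2.val v.1 := fun u v h => by
      induction h with
      | single h => exact h.2
      | tail _ h ih => exact ih.trans h.2
    exact fun v h => (hlt v v h).false
  · have hdeg := ncard_cylinder_adj hn (fun a b => f b a < f v.2.val v.1) v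
    have hpar := hf.parity v.2.val v.2.isLt v.1
    rw [rowIndicator_apply] at hpar
    rw [← ZMod.natCast_eq_one_iff_odd, GraphOrientation.indeg, hdeg]
    have hcast : (((if f v.2.val (v.1 - 1) < f v.2.val v.1 then 1 else 0) +
        (if f v.2.val (v.1 + 1) < f v.2.val v.1 then 1 else 0) +
        (if 0 < v.2.val ∧ f (v.2.val - 1) v.1 < f v.2.val v.1 then 1 else 0) +
        (if v.2.val + 1 < q ∧ f (v.2.val + 1) v.1 < f v.2.val v.1 then 1 else 0) : ℕ) : ZMod 2) =
        if v ∈ T then 1 else 0 := by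
      rw [← hpar]
      simp only [ringParity, ltInd, ite_and, Nat.pos_iff_ne_zero, ite_not]
      push_cast
      rfl
    rw [hcast]
    split_ifs with hv <;> simp [hv]

theorem vdeg_cylinder (hn : 3 ≤ n) {q : ℕ} (v : Fin n × Fin q) :
    vdeg (cycleGraph n □ pathGraph q) v =
      2 + (if 0 < v.2.val then 1 else 0) + (if v.2.val + 1 < q then 1 else 0) := by
  have h := ncard_cylinder_adj hn (fun _ _ => True) v
  simp only [and_true, if_true] at h
  simpa only [vdeg, SimpleGraph.neighborSet, SimpleGraph.adj_comm _ v] using h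

theorem ncard_edgeSet_cylinder (hn : 3 ≤ n) (m : ℕ) :
    (cycleGraph n □ pathGraph (m + 1)).edgeSet.ncard = n * (2 * m + 1) := by
  classical
  have h := (cycleGraph n □ pathGraph (m + 1)).sum_degrees_eq_twice_card_edges
  have hdeg : ∀ (v) [Fintype ((cycleGraph n □ pathGraph (m + 1)).neighborSet v)],
      (cycleGraph n □ pathGraph (m + 1)).degree v =
      2 + (if 0 < v.2.val then 1 else 0) + (if v.2.val + 1 < m + 1 then 1 else 0) := fun v _ => by
    rw [← vdeg_cylinder hn, vdeg, Set.ncard_eq_toFinset_card',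
      ← SimpleGraph.card_neighborFinset_eq_degree,
      SimpleGraph.neighborFinset]
  have hsum : ∑ r ∈ Finset.range (m + 1),
      (2 + (if 0 < r then 1 else 0) + (if r + 1 < m + 1 then 1 else 0)) = 4 * m + 2 := by
    rw [Finset.sum_add_distrib, Finset.sum_add_distrib,
      Finset.sum_range_succ' (fun r => if 0 < r then 1 else 0),
      Finset.sum_range_succ (fun r => if r + 1 < m + 1 then 1 else 0),
      Finset.sum_congr rfl fun r hr => if_pos (Nat.succ_lt_succ (Finset.mem_range.1 hr))]
    simp
    ring
  simp only [hdeg] at h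
  rw [Fintype.sum_prod_type' fun (_ : Fin n) (r : Fin (m + 1)) =>
      2 + (if 0 < r.val then 1 else 0) + (if r.val + 1 < m + 1 then 1 else 0),
    ← Finset.sum_range fun r => 2 + (if 0 < r then 1 else 0) + (if r + 1 < m + 1 then 1 else 0),
    hsum, Finset.sum_const, Finset.card_univ, Fintype.card_fin, smul_eq_mul] at h
  rw [← SimpleGraph.coe_edgeFinset, Set.ncard_coe_finset]
  linarith

theorem CondP.sum_rowIndicator (hn : 3 ≤ n) (hodd : Odd n) {q : ℕ} (hq : 1 ≤ q)
    {T : Set (Fin n × Fin q)} (h : CondP (cycleGraph n □ pathGraph q) T) :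
    ∑ r ∈ Finset.range q, ∑ k, rowIndicator T r k = 1 := by
  obtain ⟨m, rfl⟩ := Nat.exists_eq_add_of_le' hq
  rw [CondP, ncard_edgeSet_cylinder hn] at h
  rw [_root_.sum_rowIndicator, ZMod.natCast_eq_one_iff_odd]
  have hE : Odd (n * (2 * m + 1)) := hodd.mul (odd_two_mul_add_one m)
  grind

theorem exists_rowIndicator_eq_zero {n q : ℕ} {T : Set (Fin n × Fin q)}
    (h : (sourceSet T).Nonempty) : ∃ r < q, ∃ k, rowIndicator T r k = 0 := by
  classical
  obtain ⟨v, hv⟩ := h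
  exact ⟨v.2, v.2.isLt, v.1, by rw [rowIndicator_apply, if_neg hv]⟩

theorem exists_rowIndicator_ne (hn : 3 ≤ n) {q : ℕ} {T : Set (Fin n × Fin q)}
    (hsum : ∑ r ∈ Finset.range q, ∑ k, rowIndicator T r k = 1)
    (h : (sinkSet (cycleGraph n □ pathGraph q) T).Nonempty) :
    ∃ r < q, ∃ k, rowIndicator T r k ≠ if r = 0 ∨ r + 1 = q then 0 else 1 := by
  classical
  by_contra! hne
  obtain ⟨v, hv⟩ := h
  have h1 := hne v.2 v.2.isLt v.1
  have hr := v.2.isLt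
  rw [rowIndicator_apply] at h1
  obtain rfl | hq : q = 1 ∨ q ≠ 1 := em _
  · rw [Finset.sum_range_one, Finset.sum_eq_zero fun k _ => by simpa using hne 0 one_pos k] at hsum
    exact zero_ne_one hsum
  rw [sinkSet, Set.mem_ofPred_eq, vdeg_cylinder hn] at hv
  split_ifs at h1 hv <;> grind

end Cylinder

/-- Lemma (odd cylinders): for `p ≥ 3` odd and `q ≥ 1`, the cylinder `C_p □ P_q`
admits an acyclic `T`-odd orientation for every `T` satisfying `𝒫` when `q` is even,
and for every `T` satisfying `𝒫 𝒮 𝒮̄` when `q` is odd. -/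
theorem cylinder_odd (p q : ℕ) (hp : 3 ≤ p) (hpodd : Odd p) (hq : 1 ≤ q) :
    (Even q → ∀ T : Set (Fin p × Fin q),
      CondP (cycleGraph p □ pathGraph q) T →
      HasAcyclicTOddOrientation (cycleGraph p □ pathGraph q) T) ∧
    (Odd q → ∀ T : Set (Fin p × Fin q),
      CondP (cycleGraph p □ pathGraph q) T →
      CondS (cycleGraph p □ pathGraph q) T →
      CondSbar (cycleGraph p □ pathGraph q) T →
      HasAcyclicTOddOrientation (cycleGraph p □ pathGraph q) T) := by
  have : NeZero p := ⟨by omega⟩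
  refine ⟨fun hqe T hP => ?_, fun _ T hP hS hS' => ?_⟩
  · have hodd : ¬ Odd q := Nat.not_odd_iff_even.2 hqe
    exact (Admissible.hasRanking hp hpodd ⟨hP.sum_rowIndicator hp hpodd hq,
      fun h => absurd h hodd, fun h => absurd h hodd⟩).hasAcyclicTOddOrientation hp
  · have hsum := hP.sum_rowIndicator hp hpodd hq
    exact (Admissible.hasRanking hp hpodd ⟨hsum, fun _ => exists_rowIndicator_eq_zero hS.1,
      fun _ => exists_rowIndicator_ne hp hsum hS'.1⟩).hasAcyclicTOddOrientation hp
end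

section
/- Lemma (even cylinders): Let G = C_p □ P_q be a cylinder with p ≥ 4 even and q ≥ 1. Then for every T ⊆ V(G) satisfying conditions P, S and S̄, G admits an acyclic T-odd orientation. -/
open SimpleGraph

section Elimination

variable {V : Type*} (G : SimpleGraph V) [DecidableRel G.Adj]

/-- The vertices of `R` can be ranked so that every `v ∈ R` has `s false v` lower-ranked neighbours
in `R` modulo two, provided `s false v + s true v` has the parity of the degree of `v` in `G[R]`
and `s false` sums to the parity of the number of edges of `G[R]`. -/
def ParityRankable (R : Finset V) (s : Bool → V → ZMod 2) : Prop :=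
  (∀ v ∈ R, s false v + s true v = ∑ u ∈ R, if G.Adj v u then 1 else 0) →
  (∑ v ∈ R, s false v = ∑ e ∈ R.sym2, if e ∈ G.edgeSet then 1 else 0) →
  ∃ f : V → ℤ, (∀ u ∈ R, ∀ v ∈ R, G.Adj u v → f u ≠ f v) ∧
    ∀ v ∈ R, s false v = ∑ u ∈ R, if G.Adj v u ∧ f u < f v then 1 else 0

/-- The parity targets after the vertices `v ∈ S` have been deleted, as sources if `y v = false`
and as sinks if `y v = true`. -/
def deleteTarget (s : Bool → V → ZMod 2) (S : Finset V) (y : V → Bool) :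
    Bool → V → ZMod 2 :=
  fun t u => s t u + ∑ v ∈ S, if y v = t ∧ G.Adj v u then 1 else 0

variable {G}

theorem ParityRankable.congr {R : Finset V} {s s' : Bool → V → ZMod 2}
    (h : ParityRankable G R s) (hs : ∀ t, ∀ v ∈ R, s' t v = s t v) :
    ParityRankable G R s' := by
  intro h1 h2
  obtain ⟨f, hf, hf'⟩ := h (fun v hv => by rw [← hs _ v hv, ← hs _ v hv, h1 v hv])
    (by rw [← h2]; exact Finset.sum_congr rfl fun v hv => (hs _ v hv).symm)
  exact ⟨f, hf, fun v hv => by rw [hs _ v hv, hf' v hv]⟩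

theorem parityRankable_singleton (v : V) (s : Bool → V → ZMod 2) :
    ParityRankable G {v} s := by
  intro _ h2
  refine ⟨fun _ => 0, by simp, ?_⟩
  have : s false v = 0 := by
    rw [Finset.sum_singleton, Finset.sym2_singleton, Finset.sum_singleton] at h2
    simpa [Sym2.diag] using h2
  simp [this]

variable [DecidableEq V]

theorem sum_sym2_edgeSet_insert {R : Finset V} {v : V} (hv : v ∉ R) :
    (∑ e ∈ (insert v R).sym2, if e ∈ G.edgeSet then (1 : ZMod 2) else 0) =
      (∑ u ∈ R, if G.Adj v u then 1 else 0) + ∑ e ∈ R.sym2, if e ∈ G.edgeSet then 1 else 0 := by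
  rw [Finset.sym2_insert, Finset.sum_union, Finset.sum_image, Finset.sum_insert hv]
  · simp
  · intro a _ b _ h
    exact Sym2.congr_right.1 h
  · rw [Finset.disjoint_left]
    intro e he he'
    obtain ⟨b, _, rfl⟩ := Finset.mem_image.1 he
    exact hv (Finset.mk_mem_sym2_iff.1 he').1

theorem ParityRankable.insert_source {R : Finset V} {s : Bool → V → ZMod 2} {v : V}
    (hv : v ∉ R) (hs : s false v = 0)
    (h : ParityRankable G R fun t u => s t u + if t = false ∧ G.Adj v u then 1 else 0) :
    ParityRankable G (insert v R) s := by
  intro h1 h2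
  have hne : ∀ u ∈ R, u ≠ v := fun u hu e => hv (e ▸ hu)
  specialize h ?_ ?_
  · intro u hu
    have := h1 u (Finset.mem_insert_of_mem hu)
    rw [Finset.sum_insert hv] at this
    simp only [G.adj_comm u v] at this
    simp only [true_and, Bool.true_eq_false, false_and, if_false]
    linear_combination this + (if G.Adj v u then 1 else 0) * CharTwo.two_eq_zero (R := ZMod 2)
  · rw [Finset.sum_insert hv, sum_sym2_edgeSet_insert hv, hs] at h2
    simp only [true_and, Finset.sum_add_distrib]
    linear_combination h2 + (∑ u ∈ R, if G.Adj v u then 1 else 0) *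
      (CharTwo.two_eq_zero (R := ZMod 2))
  obtain ⟨f, hf, hf'⟩ := h
  obtain ⟨M, hM⟩ : ∃ M, ∀ u ∈ R, M < f u := by
    obtain ⟨M, hM⟩ := (R.image f).bddBelow
    refine ⟨M - 1, fun u hu => ?_⟩
    have := hM (Finset.mem_coe.2 (Finset.mem_image_of_mem f hu))
    omega
  refine ⟨Function.update f v M, ?_, ?_⟩
  · intro a ha b hb hab
    rw [Finset.mem_insert] at ha hb
    rcases ha with rfl | ha <;> rcases hb with rfl | hb
    · exact absurd hab (G.irrefl)
    · simpa [hne b hb] using (hM b hb).ne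
    · simpa [hne a ha] using (hM a ha).ne'
    · simpa [hne a ha, hne b hb] using hf a ha b hb hab
  · intro a ha
    rw [Finset.sum_insert hv]
    rcases Finset.mem_insert.1 ha with rfl | ha
    · rw [hs, eq_comm]
      simp only [lt_self_iff_false, and_false, if_false, zero_add]
      refine Finset.sum_eq_zero fun u hu => ?_
      simp [hne u hu, (hM u hu).le]
    · have := hf' a ha
      have e : (∑ u ∈ R, if G.Adj a u ∧ Function.update f v M u < Function.update f v M a
          then (1 : ZMod 2) else 0) = ∑ u ∈ R, if G.Adj a u ∧ f u < f a then 1 else 0 :=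
        Finset.sum_congr rfl fun u hu => by simp [hne u hu, hne a ha]
      rw [e, ← this]
      simp only [Function.update_self, ne_eq, hne a ha, not_false_eq_true,
        Function.update_of_ne, hM a ha, and_true, true_and, G.adj_comm a v]
      split_ifs
      · linear_combination -(CharTwo.two_eq_zero (R := ZMod 2))
      · ring

theorem ParityRankable.insert_sink {R : Finset V} {s : Bool → V → ZMod 2} {v : V}
    (hv : v ∉ R) (hs : s true v = 0)
    (h : ParityRankable G R fun t u => s t u + if t = true ∧ G.Adj v u then 1 else 0) :
    ParityRankable G (insert v R) s := by
  intro h1 h2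
  have hne : ∀ u ∈ R, u ≠ v := fun u hu e => hv (e ▸ hu)
  have hdeg := h1 v (Finset.mem_insert_self _ _)
  rw [Finset.sum_insert hv, hs, if_neg (G.irrefl), add_zero, zero_add] at hdeg
  specialize h ?_ ?_
  · intro u hu
    have := h1 u (Finset.mem_insert_of_mem hu)
    rw [Finset.sum_insert hv] at this
    simp only [G.adj_comm u v] at this
    simp only [true_and, Bool.false_eq_true, false_and, if_false]
    linear_combination this + (if G.Adj v u then 1 else 0) * CharTwo.two_eq_zero (R := ZMod 2)
  · rw [Finset.sum_insert hv, sum_sym2_edgeSet_insert hv, hdeg] at h2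
    simp only [Bool.false_eq_true, false_and, if_false, add_zero]
    linear_combination h2
  obtain ⟨f, hf, hf'⟩ := h
  obtain ⟨M, hM⟩ : ∃ M, ∀ u ∈ R, f u < M := by
    obtain ⟨M, hM⟩ := (R.image f).bddAbove
    refine ⟨M + 1, fun u hu => ?_⟩
    have := hM (Finset.mem_coe.2 (Finset.mem_image_of_mem f hu))
    omega
  refine ⟨Function.update f v M, ?_, ?_⟩
  · intro a ha b hb hab
    rw [Finset.mem_insert] at ha hb
    rcases ha with rfl | ha <;> rcases hb with rfl | hb
    · exact absurd hab (G.irrefl)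
    · simpa [hne b hb] using (hM b hb).ne'
    · simpa [hne a ha] using (hM a ha).ne
    · simpa [hne a ha, hne b hb] using hf a ha b hb hab
  · intro a ha
    rw [Finset.sum_insert hv]
    rcases Finset.mem_insert.1 ha with rfl | ha
    · rw [hdeg]
      simp only [lt_self_iff_false, and_false, if_false, zero_add]
      exact Finset.sum_congr rfl fun u hu => by simp [hne u hu, hM u hu]
    · have := hf' a ha
      have e : (∑ u ∈ R, if G.Adj a u ∧ Function.update f v M u < Function.update f v M a
          then (1 : ZMod 2) else 0) = ∑ u ∈ R, if G.Adj a u ∧ f u < f a then 1 else 0 :=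
        Finset.sum_congr rfl fun u hu => by simp [hne u hu, hne a ha]
      rw [e, ← this]
      simp [hne a ha, (hM a ha).le]

theorem ParityRankable.of_erase {R : Finset V} {s : Bool → V → ZMod 2} {v : V} (t : Bool)
    (hv : v ∈ R) (hs : s t v = 0)
    (h : ParityRankable G (R.erase v) fun t' u => s t' u + if t = t' ∧ G.Adj v u then 1 else 0) :
    ParityRankable G R s := by
  rw [← Finset.insert_erase hv]
  cases t
  · exact .insert_source (Finset.notMem_erase _ _) hs (by simpa only [eq_comm] using h)
  · exact .insert_sink (Finset.notMem_erase _ _) hs (by simpa only [eq_comm] using h)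

/-- An independent set of sources (or of sinks) can be deleted at once. -/
theorem ParityRankable.of_sdiff_indep (t : Bool) (S : Finset V) :
    ∀ {R : Finset V} {s : Bool → V → ZMod 2}, S ⊆ R → (∀ u ∈ S, ∀ v ∈ S, ¬ G.Adj u v) →
    (∀ v ∈ S, s t v = 0) → ParityRankable G (R \ S) (deleteTarget G s S fun _ => t) →
    ParityRankable G R s := by
  induction S using Finset.induction_on with
  | empty =>
    intro R s _ _ _ h
    simp only [Finset.sdiff_empty] at h
    exact h.congr fun t v _ => by simp [deleteTarget]
  | insert a S ha ih =>
    intro R s hR hS hs h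
    refine .of_erase t (hR (Finset.mem_insert_self _ _)) (hs a (Finset.mem_insert_self _ _)) ?_
    refine ih ?_ ?_ ?_ ?_
    · exact fun v hv => Finset.mem_erase.2
        ⟨fun e => ha (e ▸ hv), hR (Finset.mem_insert_of_mem hv)⟩
    · exact fun u hu v hv => hS u (Finset.mem_insert_of_mem hu) v (Finset.mem_insert_of_mem hv)
    · intro v hv
      simp [hs v (Finset.mem_insert_of_mem hv),
        hS a (Finset.mem_insert_self _ _) v (Finset.mem_insert_of_mem hv)]
    · rw [Finset.erase_sdiff_comm, ← Finset.sdiff_insert]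
      refine h.congr fun t' v _ => ?_
      simp [deleteTarget, Finset.sum_insert ha, add_assoc]

/-- A path whose first vertex may be deleted both as a source and as a sink, and whose inner
vertices have odd degree, can be deleted with a prescribed type for its last vertex. -/
theorem ParityRankable.of_sdiff_path (e : Bool) (m : ℕ) :
    ∀ {R : Finset V} {s : Bool → V → ZMod 2} (w : ℕ → V),
    (∀ i ≤ m + 1, w i ∈ R) →
    (∀ i j, i < j → j ≤ m + 1 → w i ≠ w j) →
    (∀ i j, i < j → j ≤ m + 1 → (G.Adj (w i) (w j) ↔ j = i + 1)) →
    (∀ t, s t (w 0) = 0) →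
    (∀ i, 0 < i → i ≤ m → s false (w i) + s true (w i) = 1) →
    ∃ y : V → Bool, y (w (m + 1)) = e ∧
      (ParityRankable G (R \ (Finset.range (m + 2)).image w)
        (deleteTarget G s ((Finset.range (m + 2)).image w) y) → ParityRankable G R s) := by
  induction m with
  | zero =>
    intro R s w hR hne hadj h0 hmid
    have h01 : w 0 ≠ w 1 := hne 0 1 (by omega) (by omega)
    have a01 : G.Adj (w 0) (w 1) := by simpa using hadj 0 1 (by omega) (by omega)
    have hS : (Finset.range (0 + 2)).image w = {w 0, w 1} := by
      ext v; simp [Finset.range_add_one, or_comm]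
    obtain ⟨t, ht⟩ : ∃ t : Bool, s e (w 1) + (if t = e then 1 else 0) = 0 := by
      generalize s e (w 1) = x
      revert x e; decide
    refine ⟨Function.update (fun _ => e) (w 0) t, by simp [h01.symm], fun h => ?_⟩
    rw [hS] at h
    refine .of_erase t (hR 0 (by omega)) (h0 t) ?_
    refine .of_erase e (v := w 1) (by simp [h01.symm, hR 1]) (by simpa [a01] using ht) ?_
    have : (R.erase (w 0)).erase (w 1) = R \ {w 0, w 1} := by
      ext v; simp; tauto
    rw [this]
    refine h.congr fun t' v _ => ?_
    simp [deleteTarget, Finset.sum_pair h01, h01.symm, add_assoc]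
  | succ m ih =>
    intro R s w hR hne hadj h0 hmid
    have h01 : w 0 ≠ w 1 := hne 0 1 (by omega) (by omega)
    have a01 : G.Adj (w 0) (w 1) := by simpa using hadj 0 1 (by omega) (by omega)
    obtain ⟨t, ht⟩ : ∃ t : Bool, ∀ t', s t' (w 1) + (if t = t' then 1 else 0) = 0 := by
      have := hmid 1 (by omega) (by omega)
      rw [Bool.exists_bool]
      simp only [Bool.forall_bool]
      revert this
      generalize s false (w 1) = x
      generalize s true (w 1) = z
      revert x z; decide
    have hS : (Finset.range (m + 1 + 2)).image w =
        insert (w 0) ((Finset.range (m + 2)).image fun i => w (i + 1)) := by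
      ext v
      simp only [Finset.mem_image, Finset.mem_range, Finset.mem_insert]
      constructor
      · rintro ⟨_ | i, hi, rfl⟩
        · exact Or.inl rfl
        · exact Or.inr ⟨i, by omega, rfl⟩
      · rintro (rfl | ⟨i, hi, rfl⟩)
        · exact ⟨0, by omega, rfl⟩
        · exact ⟨i + 1, by omega, rfl⟩
    have hn : w 0 ∉ (Finset.range (m + 2)).image fun i => w (i + 1) := by
      simp only [Finset.mem_image, Finset.mem_range, not_exists, not_and]
      exact fun i hi => (hne 0 (i + 1) (by omega) (by omega)).symm
    obtain ⟨y, hy, h⟩ := ih (R := R.erase (w 0))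
      (s := fun t' u => s t' u + if t = t' ∧ G.Adj (w 0) u then 1 else 0) (fun i => w (i + 1))
      (fun i hi => Finset.mem_erase.2
        ⟨(hne 0 (i + 1) (by omega) (by omega)).symm, hR _ (by omega)⟩)
      (fun i j hij hj => hne _ _ (by omega) (by omega))
      (fun i j hij hj => by rw [hadj _ _ (by omega) (by omega)]; omega)
      (fun t' => by simpa [a01] using ht t')
      (fun i hi him => by
        have : ¬ G.Adj (w 0) (w (i + 1)) := by
          rw [hadj _ _ (by omega) (by omega)]; omega
        simpa [this] using hmid (i + 1) (by omega) (by omega))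
    refine ⟨Function.update y (w 0) t, ?_, fun h' => ?_⟩
    · rw [Function.update_of_ne (hne 0 _ (by omega) (by omega)).symm]
      exact hy
    · refine .of_erase t (hR 0 (by omega)) (h0 t) (h ?_)
      rw [hS] at h'
      rw [Finset.erase_sdiff_comm, ← Finset.sdiff_insert]
      refine h'.congr fun t' v _ => ?_
      simp only [deleteTarget]
      rw [Finset.sum_insert hn, ← add_assoc]
      simp only [Function.update_self]
      congr 1
      refine Finset.sum_congr rfl fun u hu => ?_
      rw [Function.update_of_ne (ne_of_mem_of_not_mem hu hn)]

/-- A path whose first vertex has odd degree and whose inner vertices have even degree can be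
deleted vertex by vertex. -/
theorem parityRankable_path (m : ℕ) :
    ∀ {s : Bool → V → ZMod 2} (w : ℕ → V),
    (∀ i j, i < j → j ≤ m → w i ≠ w j) →
    (∀ i j, i < j → j ≤ m → (G.Adj (w i) (w j) ↔ j = i + 1)) →
    (∀ i < m, s false (w i) + s true (w i) = if i = 0 then 1 else 0) →
    ParityRankable G ((Finset.range (m + 1)).image w) s := by
  induction m with
  | zero =>
    intro s w _ _ _
    simpa using parityRankable_singleton (w 0) s
  | succ m ih =>
    intro s w hne hadj hs
    have hn : w 0 ∉ (Finset.range (m + 1)).image fun i => w (i + 1) := by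
      simp only [Finset.mem_image, Finset.mem_range, not_exists, not_and]
      exact fun i hi => (hne 0 (i + 1) (by omega) (by omega)).symm
    have hS : ((Finset.range (m + 1 + 1)).image w).erase (w 0) =
        (Finset.range (m + 1)).image fun i => w (i + 1) := by
      rw [Finset.range_add_one', Finset.image_insert, Finset.map_eq_image, Finset.image_image]
      exact Finset.erase_insert hn
    obtain ⟨t, ht⟩ : ∃ t : Bool, s t (w 0) = 0 := by
      have := hs 0 (by omega)
      rw [Bool.exists_bool]
      revert this
      generalize s false (w 0) = x
      generalize s true (w 0) = z
      revert x z; decide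
    refine .of_erase t (Finset.mem_image_of_mem _ (by simp)) ht ?_
    rw [hS]
    refine ih _ (fun i j hij hj => hne _ _ (by omega) (by omega))
      (fun i j hij hj => by rw [hadj _ _ (by omega) (by omega)]; omega) fun i hi => ?_
    have h1 := hs (i + 1) (by omega)
    have h2 := hadj 0 (i + 1) (by omega) (by omega)
    simp only [h2]
    rw [if_neg (by omega)] at h1
    rw [add_add_add_comm, h1, zero_add]
    cases t <;> simp

end Elimination


section Cylinder

/-- The half-infinite cylinder `C_{n+4} □ ℕ`. -/
def infiniteCylinder (n : ℕ) : SimpleGraph (ZMod (n + 4) × ℕ) where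
  Adj u v := (u.2 = v.2 ∧ (v.1 = u.1 + 1 ∨ u.1 = v.1 + 1)) ∨
    (u.1 = v.1 ∧ (v.2 = u.2 + 1 ∨ u.2 = v.2 + 1))
  symm := ⟨by
    rintro u v (⟨h, h'⟩ | ⟨h, h'⟩)
    · exact Or.inl ⟨h.symm, h'.symm⟩
    · exact Or.inr ⟨h.symm, h'.symm⟩⟩
  loopless := ⟨by
    have : Nontrivial (ZMod (n + 4)) := inferInstanceAs (Nontrivial (Fin (n + 4)))
    rintro u (⟨_, h⟩ | ⟨_, h⟩)
    · simp at h
    · omega⟩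

instance (n : ℕ) : DecidableRel (infiniteCylinder n).Adj := fun u v =>
  inferInstanceAs (Decidable ((u.2 = v.2 ∧ (v.1 = u.1 + 1 ∨ u.1 = v.1 + 1)) ∨
    (u.1 = v.1 ∧ (v.2 = u.2 + 1 ∨ u.2 = v.2 + 1))))

/-- The vertices in the first `m` rows. -/
def rows (n m : ℕ) : Finset (ZMod (n + 4) × ℕ) := Finset.univ ×ˢ Finset.range m

/-- The parity targets after the row `l + 1` has been deleted, the vertex in column `i` being
deleted as a source if `y i = false` and as a sink if `y i = true`. -/
def deleteRowTarget {n : ℕ} (s : Bool → ZMod (n + 4) × ℕ → ZMod 2) (l : ℕ)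
    (y : ZMod (n + 4) → Bool) : Bool → ZMod (n + 4) × ℕ → ZMod 2 :=
  fun t u => s t u + if u.2 = l ∧ y u.1 = t then 1 else 0

variable {n : ℕ}

theorem mem_rows {m : ℕ} {v : ZMod (n + 4) × ℕ} : v ∈ rows n m ↔ v.2 < m := by
  simp [rows]

theorem natCast_eq_natCast_of_lt {a b : ℕ} (ha : a < n + 4) (hb : b < n + 4) :
    (a : ZMod (n + 4)) = b ↔ a = b := by
  rw [ZMod.natCast_eq_natCast_iff', Nat.mod_eq_of_lt ha, Nat.mod_eq_of_lt hb]

theorem natCast_add_three : ((n + 3 : ℕ) : ZMod (n + 4)) = -1 := by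
  have : ((n + 4 : ℕ) : ZMod (n + 4)) = 0 := ZMod.natCast_self _
  push_cast at this ⊢
  linear_combination this

theorem infiniteCylinder_adj_row (c : ZMod (n + 4)) (k : ℕ) {a b : ℕ} (hab : a < b)
    (hb : b < n + 4) :
    (infiniteCylinder n).Adj (c + a, k) (c + b, k) ↔ b = a + 1 ∨ (a = 0 ∧ b = n + 3) := by
  have h1 : (c + (b : ZMod (n + 4)) = c + a + 1) ↔ b = a + 1 := by
    rw [add_assoc, add_right_inj]
    exact_mod_cast natCast_eq_natCast_of_lt (n := n) hb (show a + 1 < n + 4 by omega)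
  have h2 : (c + (a : ZMod (n + 4)) = c + b + 1) ↔ (a = 0 ∧ b = n + 3) := by
    rw [add_assoc, add_right_inj]
    rcases Nat.lt_or_ge (b + 1) (n + 4) with h | h
    · have := natCast_eq_natCast_of_lt (n := n) (show a < n + 4 by omega) h
      push_cast at this
      rw [this]; omega
    · obtain rfl : b = n + 3 := by omega
      rw [natCast_add_three, neg_add_cancel]
      have := natCast_eq_natCast_of_lt (n := n) (show a < n + 4 by omega) (show 0 < n + 4 by omega)
      rw [Nat.cast_zero] at this
      simp [this]
  simp [infiniteCylinder, h1, h2]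

theorem infiniteCylinder_adj_down {x y : ZMod (n + 4)} {j k : ℕ} (h : j < k) :
    (infiniteCylinder n).Adj (x, k) (y, j) ↔ x = y ∧ j + 1 = k := by
  simp only [infiniteCylinder]
  constructor
  · rintro (⟨h1, _⟩ | ⟨h1, h2⟩)
    · omega
    · exact ⟨h1, by omega⟩
  · rintro ⟨h1, h2⟩
    exact Or.inr ⟨h1, by omega⟩

theorem mem_image_row {c : ZMod (n + 4)} {k a m : ℕ} (h : m + a = n + 4)
    {v : ZMod (n + 4) × ℕ} :
    v ∈ (Finset.range m).image (fun j => (c + ((j + a : ℕ) : ZMod (n + 4)), k)) ↔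
      v.2 = k ∧ a ≤ (v.1 - c).val := by
  obtain ⟨i, j⟩ := v
  simp only [Finset.mem_image, Finset.mem_range, Prod.mk.injEq]
  constructor
  · rintro ⟨b, hb, rfl, rfl⟩
    refine ⟨rfl, ?_⟩
    rw [add_sub_cancel_left, ZMod.val_cast_of_lt (by omega)]
    omega
  · rintro ⟨rfl, h'⟩
    have := ZMod.val_lt (i - c)
    refine ⟨(i - c).val - a, by omega, ?_, rfl⟩
    rw [Nat.sub_add_cancel h', ZMod.natCast_zmod_val]
    ring

theorem one_le_val_sub {i c : ZMod (n + 4)} : 1 ≤ (i - c).val ↔ i ≠ c := by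
  rw [Nat.one_le_iff_ne_zero, ne_eq, ZMod.val_eq_zero, sub_eq_zero]

theorem two_le_val_sub {i c : ZMod (n + 4)} : 2 ≤ (i - c).val ↔ i ≠ c ∧ i ≠ c + 1 := by
  rw [← one_le_val_sub]
  have h : (i - c).val = 1 ↔ i = c + 1 := by
    rw [← sub_eq_iff_eq_add']
    constructor
    · intro h
      rw [← ZMod.natCast_zmod_val (i - c), h, Nat.cast_one]
    · intro h
      have := ZMod.val_cast_of_lt (n := n + 4) (a := 1) (by omega)
      rwa [Nat.cast_one, ← h] at this
  rw [ne_eq, ← h]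
  omega

theorem sum_adj_below {S : Finset (ZMod (n + 4) × ℕ)} {k : ℕ} (hS : ∀ v ∈ S, v.2 = k)
    (y : ZMod (n + 4) × ℕ → Bool) (t : Bool) {i : ZMod (n + 4)} {j : ℕ} (hj : j < k) :
    (∑ v ∈ S, if y v = t ∧ (infiniteCylinder n).Adj v (i, j) then (1 : ZMod 2) else 0) =
      if j + 1 = k ∧ (i, k) ∈ S ∧ y (i, k) = t then 1 else 0 := by
  have : ∀ v ∈ S, (if y v = t ∧ (infiniteCylinder n).Adj v (i, j) then (1 : ZMod 2) else 0) =
      if v = (i, k) then (if j + 1 = k ∧ y (i, k) = t then 1 else 0) else 0 := by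
    rintro ⟨a, b⟩ hv
    obtain rfl : b = k := hS _ hv
    rw [← ite_and]
    refine if_congr ?_ rfl rfl
    rw [infiniteCylinder_adj_down hj]
    simp only [Prod.mk.injEq, and_true]
    constructor
    · rintro ⟨h, rfl, h'⟩; exact ⟨rfl, h', h⟩
    · rintro ⟨rfl, h', h⟩; exact ⟨h, rfl, h'⟩
  rw [Finset.sum_congr rfl this, Finset.sum_ite_eq', ← ite_and]
  exact if_congr (by tauto) rfl rfl

theorem add_ite_eq_zero {x : Bool → ZMod 2} (h : x false + x true = 1) {t : Bool} (ht : x t = 1)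
    (t' : Bool) : x t' + (if t = t' then 1 else 0) = 0 := by
  revert h ht
  cases t <;> cases t' <;> simp only [Bool.false_eq_true, Bool.true_eq_false, if_true, if_false] <;>
    generalize x true = b <;> generalize x false = a <;> revert a b <;> decide

/-- A row in which two adjacent vertices have opposite types can be deleted, with a prescribed
type for the vertex before those two. -/
theorem ParityRankable.of_deleteRow {l : ℕ} {s : Bool → ZMod (n + 4) × ℕ → ZMod 2}
    (hs : ∀ i, s false (i, l + 1) + s true (i, l + 1) = 1) {c : ZMod (n + 4)} {t : Bool}
    (hc : s t (c, l + 1) = 0) (hc' : s t (c + 1, l + 1) = 1) (e : Bool) :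
    ∃ y : ZMod (n + 4) → Bool, y c = t ∧ y (c - 1) = e ∧
      (ParityRankable (infiniteCylinder n) (rows n (l + 1)) (deleteRowTarget s l y) →
        ParityRankable (infiniteCylinder n) (rows n (l + 2)) s) := by
  have hc0 : ((c, l + 1) : ZMod (n + 4) × ℕ) = (c + ((0 : ℕ) : ZMod (n + 4)), l + 1) := by simp
  have hadj : ∀ b, 0 < b → b < n + 4 → ((infiniteCylinder n).Adj (c, l + 1)
      (c + (b : ZMod (n + 4)), l + 1) ↔ b = 1 ∨ b = n + 3) := fun b hb hb' => by
    rw [hc0, infiniteCylinder_adj_row c (l + 1) hb hb']; simp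
  obtain ⟨y, hy, h⟩ := ParityRankable.of_sdiff_path (G := infiniteCylinder n) e (n + 1)
    (R := (rows n (l + 2)).erase (c, l + 1))
    (s := fun t' u => s t' u + if t = t' ∧ (infiniteCylinder n).Adj (c, l + 1) u then 1 else 0)
    (fun j => (c + ((j + 1 : ℕ) : ZMod (n + 4)), l + 1))
    (by
      intro i hi
      rw [Finset.mem_erase, mem_rows, hc0, ne_eq, Prod.mk.injEq, add_right_inj,
        natCast_eq_natCast_of_lt (by omega) (by omega)]
      simp)
    (by
      intro i j hij hj
      rw [ne_eq, Prod.mk.injEq, add_right_inj, natCast_eq_natCast_of_lt (by omega) (by omega)]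
      omega)
    (by
      intro i j hij hj
      rw [infiniteCylinder_adj_row _ _ (by omega) (by omega)]
      omega)
    (by
      intro t'
      have h1 := (hadj 1 (by omega) (by omega)).2 (Or.inl rfl)
      simp only [zero_add]
      rw [Nat.cast_one] at h1 ⊢
      simpa only [h1, and_true] using add_ite_eq_zero (x := fun t' => s t' (c + 1, l + 1))
        (hs _) hc' t')
    (by
      intro i hi hi'
      have h1 := hadj (i + 1) (by omega) (by omega)
      simp only [h1]
      rw [if_neg (by omega), if_neg (by omega), add_zero, add_zero, hs])
  have hS := fun v : ZMod (n + 4) × ℕ =>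
    mem_image_row (show n + 1 + 2 + 1 = n + 4 by omega) (c := c) (k := l + 1) (v := v)
  simp only [one_le_val_sub] at hS
  generalize (Finset.range (n + 1 + 2)).image
    (fun j => (c + ((j + 1 : ℕ) : ZMod (n + 4)), l + 1)) = S at h hS
  refine ⟨fun i => if i = c then t else y (i, l + 1), by simp, ?_, fun hg => ?_⟩
  · have : Nontrivial (ZMod (n + 4)) := inferInstanceAs (Nontrivial (Fin (n + 4)))
    rw [natCast_add_three, ← sub_eq_add_neg] at hy
    simpa using hy
  · refine .of_erase t (by simp [mem_rows]) hc (h ?_)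
    have hR : (rows n (l + 2)).erase (c, l + 1) \ S = rows n (l + 1) := by
      ext ⟨i, j⟩
      rw [Finset.mem_sdiff, hS, Finset.mem_erase, mem_rows, mem_rows, ne_eq, Prod.mk.injEq]
      grind
    rw [hR]
    refine hg.congr fun t' u hu => ?_
    obtain ⟨i, j⟩ := u
    rw [mem_rows] at hu
    simp only at hu
    simp only [deleteTarget, deleteRowTarget]
    rw [sum_adj_below (fun v hv => ((hS v).1 hv).1) _ _ hu]
    simp only [hS, add_assoc, infiniteCylinder_adj_down hu, Nat.add_right_cancel_iff]
    congr 1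
    rcases eq_or_ne i c with rfl | hi
    · simp [and_comm]
    · simp [hi, hi.symm]

/-- If all vertices of a row have the same type, the row can be deleted. -/
theorem ParityRankable.of_deleteRow_const (hn : 2 ∣ n + 4) {l : ℕ}
    {s : Bool → ZMod (n + 4) × ℕ → ZMod 2} {t : Bool} (hs : ∀ i, s t (i, l + 1) = 0)
    (h : ParityRankable (infiniteCylinder n) (rows n (l + 1)) (deleteRowTarget s l fun _ => t)) :
    ParityRankable (infiniteCylinder n) (rows n (l + 2)) s := by
  have hadj : ∀ i j : ZMod (n + 4), (infiniteCylinder n).Adj (i, l + 1) (j, l + 1) ↔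
      i = j - 1 ∨ i = j + 1 := fun i j => by
    simp [infiniteCylinder, eq_sub_iff_add_eq, eq_comm]
  have hS : ∀ x v, v ∈ (Finset.univ.filter fun i => ZMod.castHom hn (ZMod 2) i = x) ×ˢ {l + 1} ↔
      ZMod.castHom hn (ZMod 2) v.1 = x ∧ v.2 = l + 1 := by
    simp only [Finset.mem_product, Finset.mem_filter, Finset.mem_univ, true_and,
      Finset.mem_singleton, implies_true]
  generalize hS0 : (Finset.univ.filter fun i => ZMod.castHom hn (ZMod 2) i = 0) ×ˢ {l + 1} = S₀
  generalize hS1 : (Finset.univ.filter fun i => ZMod.castHom hn (ZMod 2) i = 1) ×ˢ {l + 1} = S₁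
  have h0 := hS 0
  have h1 := hS 1
  rw [hS0] at h0
  rw [hS1] at h1
  have h01 : ∀ x : ZMod 2, x = 0 ∨ x = 1 := by decide
  have hx : ∀ x : ZMod 2, x + 1 ≠ x := by decide
  have hx' : ∀ x : ZMod 2, x - 1 = x + 1 := by decide
  have hind : ∀ (x : ZMod 2) (u v : ZMod (n + 4) × ℕ),
      (ZMod.castHom hn (ZMod 2) u.1 = x ∧ u.2 = l + 1) →
      (ZMod.castHom hn (ZMod 2) v.1 = x ∧ v.2 = l + 1) → ¬ (infiniteCylinder n).Adj u v := by
    rintro x ⟨i, _⟩ ⟨j, _⟩ ⟨rfl, rfl⟩ ⟨hj, rfl⟩ h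
    rcases (hadj i j).1 h with rfl | rfl
    · simp only [map_sub, map_one, hx'] at hj
      exact hx _ hj.symm
    · simp only [map_add, map_one] at hj
      exact hx _ hj.symm
  refine .of_sdiff_indep t S₀ ?_ (fun u hu v hv => hind 0 u v ((h0 u).1 hu) ((h0 v).1 hv)) ?_ ?_
  · intro v hv
    rw [mem_rows, ((h0 v).1 hv).2]
    omega
  · rintro ⟨i, k⟩ hv
    obtain rfl : k = l + 1 := ((h0 _).1 hv).2
    exact hs i
  refine .of_sdiff_indep t S₁ ?_ (fun u hu v hv => hind 1 u v ((h1 u).1 hu) ((h1 v).1 hv)) ?_ ?_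
  · intro v hv
    rw [Finset.mem_sdiff, mem_rows, h0, ((h1 v).1 hv).1, ((h1 v).1 hv).2]
    simp
  · rintro ⟨i, k⟩ hv
    obtain ⟨hi, rfl : k = l + 1⟩ := (h1 _).1 hv
    simp only at hi
    rw [deleteTarget, hs, zero_add]
    have hne : i - 1 ≠ i + 1 := by
      intro h
      have : ((2 : ℕ) : ZMod (n + 4)) = (0 : ℕ) := by
        push_cast
        linear_combination -h
      rw [natCast_eq_natCast_of_lt (by omega) (by omega)] at this
      omega
    have hfil : (S₀.filter fun v => t = t ∧ (infiniteCylinder n).Adj v (i, l + 1)) =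
        {(i - 1, l + 1), (i + 1, l + 1)} := by
      ext ⟨j, k⟩
      rw [Finset.mem_filter, h0, Finset.mem_insert, Finset.mem_singleton]
      simp only [Prod.mk.injEq, true_and]
      constructor
      · rintro ⟨⟨_, rfl⟩, h⟩
        simpa using (hadj j i).1 h
      · rintro (⟨rfl, rfl⟩ | ⟨rfl, rfl⟩)
        · exact ⟨⟨by rw [map_sub, map_one, hi, sub_self], rfl⟩, (hadj _ _).2 (Or.inl rfl)⟩
        · exact ⟨⟨by rw [map_add, map_one, hi]; decide, rfl⟩, (hadj _ _).2 (Or.inr rfl)⟩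
    rw [← Finset.sum_filter, hfil, Finset.sum_pair (by simpa using hne)]
    decide
  · have hR : (rows n (l + 2) \ S₀) \ S₁ = rows n (l + 1) := by
      ext ⟨i, j⟩
      rw [Finset.mem_sdiff, Finset.mem_sdiff, h0, h1, mem_rows, mem_rows]
      have := h01 (ZMod.castHom hn (ZMod 2) i)
      simp only
      grind
    rw [hR]
    refine h.congr fun t' u hu => ?_
    obtain ⟨i, j⟩ := u
    rw [mem_rows] at hu
    simp only at hu
    simp only [deleteTarget, deleteRowTarget]
    rw [sum_adj_below (fun v hv => ((h0 v).1 hv).2) _ _ hu,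
      sum_adj_below (fun v hv => ((h1 v).1 hv).2) _ _ hu, add_assoc]
    congr 1
    simp only [h0, h1]
    rcases h01 (ZMod.castHom hn (ZMod 2) i) with hi | hi <;> simp only [hi] <;>
      by_cases hj : j = l <;> simp [hj]

/-- A row all of whose vertices have the same type can be deleted together with the row below if
every vertex of the latter may be deleted both as a source and as a sink. -/
theorem ParityRankable.of_deleteRow_deleteRow {l : ℕ}
    {s : Bool → ZMod (n + 4) × ℕ → ZMod 2} {t : Bool} (hs : ∀ i, s t (i, l + 2) = 1)
    (hs' : ∀ i, s false (i, l + 2) + s true (i, l + 2) = 1) (hs0 : ∀ t i, s t (i, l + 1) = 0)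
    (c : ZMod (n + 4)) (e : Bool) :
    ∃ y : ZMod (n + 4) → Bool, y c = t ∧ y (c - 1) = e ∧
      (ParityRankable (infiniteCylinder n) (rows n (l + 1)) (deleteRowTarget s l y) →
        ParityRankable (infiniteCylinder n) (rows n (l + 3)) s) := by
  obtain ⟨v, hv⟩ : ∃ v : ℕ → ℕ → ZMod (n + 4) × ℕ, ∀ a k, v a k = (c + (a : ZMod (n + 4)), k) :=
    ⟨_, fun _ _ => rfl⟩
  have hv0 : ∀ k, v 0 k = (c, k) := by simp [hv]
  have hv1 : ∀ k, v 1 k = (c + 1, k) := by simp [hv]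
  have hinj : ∀ a b k k', a < n + 4 → b < n + 4 → (v a k = v b k' ↔ a = b ∧ k = k') :=
    fun a b k k' ha hb => by
      rw [hv, hv, Prod.mk.injEq, add_right_inj, natCast_eq_natCast_of_lt ha hb]
  have hrow : ∀ a b k, a < b → b < n + 4 →
      ((infiniteCylinder n).Adj (v a k) (v b k) ↔ b = a + 1 ∨ (a = 0 ∧ b = n + 3)) :=
    fun a b k hab hb => by rw [hv, hv, infiniteCylinder_adj_row c k hab hb]
  have hcol : ∀ a b, a < n + 4 → b < n + 4 →
      ((infiniteCylinder n).Adj (v a (l + 2)) (v b (l + 1)) ↔ a = b) := fun a b ha hb => by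
    rw [hv, hv, infiniteCylinder_adj_down (show l + 1 < l + 2 by omega), add_right_inj,
      natCast_eq_natCast_of_lt ha hb]
    simp
  have hcol' : ∀ a b, a < n + 4 → b < n + 4 →
      ((infiniteCylinder n).Adj (v a (l + 1)) (v b (l + 2)) ↔ a = b) := fun a b ha hb => by
    rw [SimpleGraph.adj_comm, hcol b a hb ha]; exact eq_comm
  obtain ⟨s₁, h₁⟩ : ∃ s₁ : Bool → ZMod (n + 4) × ℕ → ZMod 2, ∀ t' u, s₁ t' u =
      s t' u + if t = t' ∧ (infiniteCylinder n).Adj (v 0 (l + 1)) u then 1 else 0 :=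
    ⟨_, fun _ _ => rfl⟩
  obtain ⟨s₂, h₂⟩ : ∃ s₂ : Bool → ZMod (n + 4) × ℕ → ZMod 2, ∀ t' u, s₂ t' u =
      s₁ t' u + if t = t' ∧ (infiniteCylinder n).Adj (v 0 (l + 2)) u then 1 else 0 :=
    ⟨_, fun _ _ => rfl⟩
  obtain ⟨s₃, h₃⟩ : ∃ s₃ : Bool → ZMod (n + 4) × ℕ → ZMod 2, ∀ t' u, s₃ t' u =
      s₂ t' u + if t = t' ∧ (infiniteCylinder n).Adj (v 1 (l + 2)) u then 1 else 0 :=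
    ⟨_, fun _ _ => rfl⟩
  have hflip : ∀ i t', s t' (i, l + 2) + (if t = t' then 1 else 0) = 0 := fun i =>
    add_ite_eq_zero (x := fun t' => s t' (i, l + 2)) (hs' i) (hs i)
  have e₁ : s t (v 0 (l + 1)) = 0 := by rw [hv, hs0]
  have e₂ : s₁ t (v 0 (l + 2)) = 0 := by
    rw [h₁, if_pos ⟨rfl, (hcol' _ _ (by omega) (by omega)).2 rfl⟩, hv, hs]; decide
  have e₃ : s₂ t (v 1 (l + 2)) = 0 := by
    rw [h₂, h₁, if_neg (mt And.right (mt (hcol' 0 1 (by omega) (by omega)).1 (by omega))),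
      if_pos ⟨rfl, (hrow 0 1 (l + 2) (by omega) (by omega)).2 (by omega)⟩, hv, hs]
    decide
  have hR₁ : v 0 (l + 2) ∈ (rows n (l + 3)).erase (v 0 (l + 1)) := by
    rw [Finset.mem_erase, ne_eq, hinj _ _ _ _ (by omega) (by omega), mem_rows, hv]
    simp
  have hR₂ : v 1 (l + 2) ∈ ((rows n (l + 3)).erase (v 0 (l + 1))).erase (v 0 (l + 2)) := by
    rw [Finset.mem_erase, Finset.mem_erase, ne_eq, ne_eq, hinj _ _ _ _ (by omega) (by omega),
      hinj _ _ _ _ (by omega) (by omega), mem_rows, hv]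
    simp
  obtain ⟨y, -, h⟩ := ParityRankable.of_sdiff_path (G := infiniteCylinder n) true n
    (R := (((rows n (l + 3)).erase (v 0 (l + 1))).erase (v 0 (l + 2))).erase (v 1 (l + 2)))
    (s := s₃) (fun j => v (j + 2) (l + 2))
    (by
      intro i hi
      simp only [Finset.mem_erase, ne_eq]
      rw [hinj _ _ _ _ (by omega) (by omega), hinj _ _ _ _ (by omega) (by omega),
        hinj _ _ _ _ (by omega) (by omega), mem_rows, hv]
      grind)
    (by
      intro i j hij hj
      rw [ne_eq, hinj _ _ _ _ (by omega) (by omega)]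
      omega)
    (by
      intro i j hij hj
      rw [hrow _ _ _ (by omega) (by omega)]
      omega)
    (by
      intro t'
      have a1 := mt (hcol' 0 2 (by omega) (by omega)).1 (by omega)
      have a2 := mt (hrow 0 2 (l + 2) (by omega) (by omega)).1 (by omega)
      have a3 := (hrow 1 2 (l + 2) (by omega) (by omega)).2 (by omega)
      simp only [zero_add, h₃, h₂, h₁, a1, a2, a3, and_false, if_false, add_zero, and_true]
      rw [hv]
      exact hflip _ _)
    (by
      intro i hi hi'
      have a1 := mt (hcol' 0 (i + 2) (by omega) (by omega)).1 (by omega)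
      have a2 := mt (hrow 0 (i + 2) (l + 2) (by omega) (by omega)).1 (by omega)
      have a3 := mt (hrow 1 (i + 2) (l + 2) (by omega) (by omega)).1 (by omega)
      simp only [h₃, h₂, h₁, a1, a2, a3, and_false, if_false, add_zero]
      rw [hv]
      exact hs' _)
  have hS := fun u : ZMod (n + 4) × ℕ =>
    mem_image_row (show n + 2 + 2 = n + 4 by omega) (c := c) (k := l + 2) (v := u)
  simp only [two_le_val_sub, ← hv] at hS
  generalize (Finset.range (n + 2)).image (fun j => v (j + 2) (l + 2)) = S at h hS
  obtain ⟨y', hy', h'⟩ := ParityRankable.of_sdiff_path (G := infiniteCylinder n) e (n + 1)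
    (R := (((rows n (l + 3)).erase (v 0 (l + 1))).erase (v 0 (l + 2))).erase (v 1 (l + 2)) \ S)
    (s := deleteTarget (infiniteCylinder n) s₃ S y) (fun j => v (j + 1) (l + 1))
    (by
      intro i hi
      simp only [Finset.mem_sdiff, Finset.mem_erase, ne_eq]
      rw [hinj _ _ _ _ (by omega) (by omega), hinj _ _ _ _ (by omega) (by omega),
        hinj _ _ _ _ (by omega) (by omega), mem_rows, hS, hv]
      simp)
    (by
      intro i j hij hj
      rw [ne_eq, hinj _ _ _ _ (by omega) (by omega)]
      omega)
    (by
      intro i j hij hj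
      rw [hrow _ _ _ (by omega) (by omega)]
      omega)
    (by
      intro t'
      have a1 := hrow 0 1 (l + 1) (by omega) (by omega)
      have a2 := hcol 0 1 (by omega) (by omega)
      have a3 := hcol 1 1 (by omega) (by omega)
      have := sum_adj_below (fun u hu => ((hS u).1 hu).1) y t' (i := c + 1)
        (show l + 1 < l + 2 by omega)
      rw [← hv1] at this
      simp only [zero_add, deleteTarget, h₃, h₂, h₁, a1, a2, a3, this, hS]
      rw [hv, hs0]
      cases t <;> cases t' <;> simp <;> decide)
    (by
      intro i hi hi'
      have a1 := mt (hrow 0 (i + 1) (l + 1) (by omega) (by omega)).1 (by omega)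
      have a2 := mt (hcol 0 (i + 1) (by omega) (by omega)).1 (by omega)
      have a3 := mt (hcol 1 (i + 1) (by omega) (by omega)).1 (by omega)
      have := fun t' => sum_adj_below (fun u hu => ((hS u).1 hu).1) y t'
        (i := c + ((i + 1 : ℕ) : ZMod (n + 4))) (show l + 1 < l + 2 by omega)
      simp only [← hv] at this
      have hmem : v (i + 1) (l + 2) ∈ S := by
        have b1 := hinj (i + 1) 0 (l + 2) (l + 2) (by omega) (by omega)
        have b2 := hinj (i + 1) 1 (l + 2) (l + 2) (by omega) (by omega)
        rw [hS]
        rw [hv0, Prod.ext_iff] at b1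
        rw [hv1, Prod.ext_iff] at b2
        rw [hv] at b1 b2 ⊢
        simp only [and_true] at b1 b2 ⊢
        simp only [ne_eq, b1, b2, true_and]
        omega
      simp only [deleteTarget, h₃, h₂, h₁, a1, a2, a3, this, hmem, and_false, if_false, add_zero,
        true_and]
      simp only [hv, hs0]
      cases y (c + ((i + 1 : ℕ) : ZMod (n + 4)), l + 2) <;> simp)
  have hS' := fun u : ZMod (n + 4) × ℕ =>
    mem_image_row (show n + 1 + 2 + 1 = n + 4 by omega) (c := c) (k := l + 1) (v := u)
  simp only [one_le_val_sub, ← hv] at hS'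
  generalize (Finset.range (n + 1 + 2)).image (fun j => v (j + 1) (l + 1)) = S' at h' hS'
  refine ⟨fun i => if i = c then t else y' (i, l + 1), by simp, ?_, fun hg => ?_⟩
  · have : Nontrivial (ZMod (n + 4)) := inferInstanceAs (Nontrivial (Fin (n + 4)))
    rw [hv, natCast_add_three, ← sub_eq_add_neg] at hy'
    simpa using hy'
  · refine .of_erase t (by simp [mem_rows, hv]) e₁ ?_
    simp only [← h₁]
    refine .of_erase t hR₁ e₂ ?_
    simp only [← h₂]
    refine .of_erase t hR₂ e₃ ?_
    simp only [← h₃]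
    refine h (h' ?_)
    have hR : ((((rows n (l + 3)).erase (v 0 (l + 1))).erase (v 0 (l + 2))).erase (v 1 (l + 2)) \ S)
        \ S' = rows n (l + 1) := by
      ext ⟨i, j⟩
      simp only [Finset.mem_sdiff, hS, hS', Finset.mem_erase, mem_rows, ne_eq, hv0, hv1,
        Prod.mk.injEq]
      grind
    rw [hR]
    refine hg.congr fun t' u hu => ?_
    obtain ⟨i, j⟩ := u
    rw [mem_rows] at hu
    simp only at hu
    simp only [deleteTarget, deleteRowTarget]
    rw [sum_adj_below (fun v hv => ((hS v).1 hv).1) _ _ (by omega),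
      sum_adj_below (fun v hv => ((hS' v).1 hv).1) _ _ hu]
    simp only [hS', h₃, h₂, h₁, hv0, hv1, infiniteCylinder_adj_down hu,
      infiniteCylinder_adj_down (show j < l + 2 by omega), Nat.add_right_cancel_iff]
    have : ¬ (j = l + 1) := by omega
    simp only [this, false_and, and_false, if_false, add_zero, add_assoc]
    congr 1
    rcases eq_or_ne i c with rfl | hi
    · simp [and_comm]
    · simp [hi, hi.symm]

/-- The parity targets for the first `m` rows add up to the degree. -/
def TargetsSumToDegree (m : ℕ) (s : Bool → ZMod (n + 4) × ℕ → ZMod 2) : Prop :=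
  ∀ i k, k < m → s false (i, k) + s true (i, k) =
    (if k = 0 then 1 else 0) + (if k + 1 = m then 1 else 0)

/-- There are both a potential source and a potential sink in the first `m` rows. -/
def HasSourceAndSink (m : ℕ) (s : Bool → ZMod (n + 4) × ℕ → ZMod 2) : Prop :=
  ∀ t, ∃ i k, k < m ∧ s t (i, k) = 0

theorem TargetsSumToDegree.deleteRowTarget {l m : ℕ} {s : Bool → ZMod (n + 4) × ℕ → ZMod 2}
    (h : TargetsSumToDegree m s) (hm : l + 2 ≤ m) (y : ZMod (n + 4) → Bool) :
    TargetsSumToDegree (l + 1) (deleteRowTarget s l y) := by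
  intro i k hk
  have h1 := h i k (by omega)
  rw [if_neg (show ¬ k + 1 = m by omega), add_zero] at h1
  simp only [_root_.deleteRowTarget, Nat.add_right_cancel_iff]
  rw [← h1]
  cases y i <;> simp <;> ring

theorem exists_deleteRowTarget {l m : ℕ} {s : Bool → ZMod (n + 4) × ℕ → ZMod 2}
    (h : TargetsSumToDegree m s) (hm : l + 2 ≤ m) {c : ZMod (n + 4)} {t : Bool}
    {P : (ZMod (n + 4) → Bool) → Prop} (hP : ∀ e, ∃ y, y c = t ∧ y (c - 1) = e ∧ P y) :
    ∃ y, P y ∧ TargetsSumToDegree (l + 1) (deleteRowTarget s l y) ∧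
      HasSourceAndSink (l + 1) (deleteRowTarget s l y) := by
  have hex : ∀ a b : ZMod 2, ∃ e : Bool, a + (if e = false then 1 else 0) = b := by decide
  have key : ∀ b, ∃ y, P y ∧ deleteRowTarget s l y false (c - 1, l) = b ∧ y c = t := fun b => by
    obtain ⟨e, he⟩ := hex (s false (c - 1, l)) b
    obtain ⟨y, hy, hy', hPy⟩ := hP e
    exact ⟨y, hPy, by simpa [deleteRowTarget, hy'] using he, hy⟩
  rcases Nat.eq_zero_or_pos l with rfl | hl
  · obtain ⟨y, hPy, hy, -⟩ := key 0
    have h' := h.deleteRowTarget hm y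
    refine ⟨y, hPy, h', ?_⟩
    have := h' (c - 1) 0 (by omega)
    rw [hy, zero_add] at this
    rintro (_ | _)
    · exact ⟨_, _, by omega, hy⟩
    · exact ⟨_, _, by omega, this.trans (by decide)⟩
  · obtain ⟨y, hPy, hy, hyc⟩ := key (s false (c, l) + (if t = false then 1 else 0) + 1)
    have h' := h.deleteRowTarget hm y
    refine ⟨y, hPy, h', ?_⟩
    have hc : deleteRowTarget s l y false (c, l) = s false (c, l) + (if t = false then 1 else 0) := by
      simp [deleteRowTarget, hyc]
    rw [← hc] at hy
    have h1 := h' c l (by omega)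
    have h2 := h' (c - 1) l (by omega)
    rw [if_neg (by omega), if_pos rfl, zero_add] at h1 h2
    have : ∀ a b a' b' : ZMod 2, a' = a + 1 → a + b = 1 → a' + b' = 1 →
      (a = 0 ∨ a' = 0) ∧ (b = 0 ∨ b' = 0) := by
      rintro a b _ b' rfl
      revert a b b'
      decide
    obtain ⟨h3, h4⟩ := this _ _ _ _ hy h1 h2
    rintro (_ | _)
    · rcases h3 with h3 | h3 <;> exact ⟨_, _, by omega, h3⟩
    · rcases h4 with h4 | h4 <;> exact ⟨_, _, by omega, h4⟩

theorem parityRankable_rows_one {s : Bool → ZMod (n + 4) × ℕ → ZMod 2}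
    (h : TargetsSumToDegree 1 s) (h' : HasSourceAndSink 1 s) :
    ParityRankable (infiniteCylinder n) (rows n 1) s := by
  obtain ⟨c, k, hk, hc⟩ := h' false
  obtain rfl : k = 0 := by omega
  have hc0 : ((c, 0) : ZMod (n + 4) × ℕ) = (c + ((0 : ℕ) : ZMod (n + 4)), 0) := by simp
  refine .of_erase false (by simp [mem_rows]) hc ?_
  have hS : (rows n 1).erase (c, 0) = (Finset.range (n + 2 + 1)).image
      (fun j => (c + ((j + 1 : ℕ) : ZMod (n + 4)), 0)) := by
    ext ⟨i, k⟩
    rw [mem_image_row (by omega), one_le_val_sub, Finset.mem_erase, mem_rows]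
    simp
    tauto
  rw [hS]
  refine parityRankable_path (n + 2) _ ?_ ?_ ?_
  · intro i j hij hj
    rw [ne_eq, Prod.mk.injEq, add_right_inj, natCast_eq_natCast_of_lt (by omega) (by omega)]
    omega
  · intro i j hij hj
    rw [infiniteCylinder_adj_row _ _ (by omega) (by omega)]
    omega
  · intro i hi
    have h1 : (infiniteCylinder n).Adj (c, 0) (c + ((i + 1 : ℕ) : ZMod (n + 4)), 0) ↔ i = 0 := by
      rw [hc0, infiniteCylinder_adj_row _ _ (by omega) (by omega)]
      omega
    have h2 := h (c + ((i + 1 : ℕ) : ZMod (n + 4))) 0 (by omega)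
    rw [add_add_add_comm, h2]
    simp only [h1]
    by_cases hi : i = 0
    · simp [hi]; decide
    · simp [hi]; decide

theorem parityRankable_rows (hn : 2 ∣ n + 4) (m : ℕ) :
    ∀ {s : Bool → ZMod (n + 4) × ℕ → ZMod 2}, TargetsSumToDegree (m + 1) s →
      HasSourceAndSink (m + 1) s → ParityRankable (infiniteCylinder n) (rows n (m + 1)) s := by
  induction m using Nat.strong_induction_on with
  | _ m ih =>
  intro s h hs
  rcases m with _ | l
  · exact parityRankable_rows_one h hs
  have h01 : ∀ x : ZMod 2, x = 0 ∨ x = 1 := by decide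
  have htop : ∀ i, s false (i, l + 1) + s true (i, l + 1) = 1 := fun i => by
    rw [h i (l + 1) (by omega)]; simp
  by_cases hconst : ∃ c, s false (c, l + 1) ≠ s false (c + 1, l + 1)
  · obtain ⟨c, hc⟩ := hconst
    obtain ⟨t, ht, ht'⟩ : ∃ t, s t (c, l + 1) = 0 ∧ s t (c + 1, l + 1) = 1 := by
      have : ∀ a b a' b' : ZMod 2, a ≠ a' → a + b = 1 → a' + b' = 1 →
        (a = 0 ∧ a' = 1) ∨ (b = 0 ∧ b' = 1) := by decide
      rcases this _ _ _ _ hc (htop c) (htop (c + 1)) with h | h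
      · exact ⟨false, h⟩
      · exact ⟨true, h⟩
    obtain ⟨y, hy, h1, h2⟩ := exists_deleteRowTarget h le_rfl
      (ParityRankable.of_deleteRow htop ht ht')
    exact hy (ih l (by omega) h1 h2)
  push Not at hconst
  have hconst' : ∀ i, s false (i, l + 1) = s false (0, l + 1) := fun i => by
    have : ∀ a : ℕ, s false ((a : ZMod (n + 4)), l + 1) = s false (0, l + 1) := fun a => by
      induction a with
      | zero => simp
      | succ a ih => rw [Nat.cast_succ, ← hconst, ih]
    rw [← ZMod.natCast_zmod_val i, this]
  obtain ⟨t, ht, ht'⟩ : ∃ t, (∀ i, s t (i, l + 1) = 0) ∧ ∀ i, s (!t) (i, l + 1) = 1 := by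
    have : ∀ a b : ZMod 2, a + b = 1 → (a = 0 → b = 1) ∧ (a = 1 → b = 0) := by decide
    rcases h01 (s false (0, l + 1)) with h0 | h0
    · exact ⟨false, fun i => by rw [hconst', h0],
        fun i => (this _ _ (htop i)).1 (by rw [hconst', h0])⟩
    · exact ⟨true, fun i => (this _ _ (htop i)).2 (by rw [hconst', h0]),
        fun i => by rw [Bool.not_true, hconst', h0]⟩
  have hsum : ∀ i k, k < l + 2 → s t (i, k) + s (!t) (i, k) =
      (if k = 0 then 1 else 0) + (if k + 1 = l + 2 then 1 else 0) := fun i k hk => by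
    rw [← h i k hk]
    cases t
    · rfl
    · exact add_comm _ _
  obtain ⟨i₀, k₀, hk₀, hi₀⟩ := hs (!t)
  replace hk₀ : k₀ < l + 1 := by
    rcases Nat.lt_or_ge k₀ (l + 1) with h | h
    · exact h
    · obtain rfl : k₀ = l + 1 := by omega
      rw [ht'] at hi₀
      exact absurd hi₀ (by decide)
  have hnew : ∀ u : ZMod (n + 4) × ℕ, deleteRowTarget s l (fun _ => t) (!t) u = s (!t) u := fun u => by
    cases t <;> simp [deleteRowTarget]
  have hnew' : ∀ i, deleteRowTarget s l (fun _ => t) t (i, l) = s t (i, l) + 1 := fun i => by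
    simp [deleteRowTarget]
  have hfinish : (∃ i, s t (i, l) = 1) →
      ParityRankable (infiniteCylinder n) (rows n (l + 2)) s := by
    rintro ⟨i, hi⟩
    refine .of_deleteRow_const hn ht (ih l (by omega) (h.deleteRowTarget le_rfl _) fun t' => ?_)
    rcases Bool.eq_or_eq_not t' t with rfl | rfl
    · exact ⟨i, l, by omega, by rw [hnew', hi]; decide⟩
    · exact ⟨i₀, k₀, hk₀, by rw [hnew, hi₀]⟩
  rcases l with _ | l
  · obtain rfl : k₀ = 0 := by omega
    refine hfinish ⟨i₀, ?_⟩
    have := hsum i₀ 0 (by omega)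
    rw [hi₀, add_zero] at this
    simpa using this
  by_cases hex : ∃ i, s t (i, l + 1) = 1
  · exact hfinish hex
  push Not at hex
  have hboth : ∀ t' i, s t' (i, l + 1) = 0 := fun t' i => by
    have h1 := (h01 (s t (i, l + 1))).resolve_right (hex i)
    have h2 := hsum i (l + 1) (by omega)
    rw [h1, zero_add, if_neg (by omega), if_neg (by omega), add_zero] at h2
    rcases Bool.eq_or_eq_not t' t with rfl | rfl
    · exact h1
    · exact h2
  obtain ⟨y, hy, h1, h2⟩ := exists_deleteRowTarget h (show l + 2 ≤ l + 3 by omega)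
    (ParityRankable.of_deleteRow_deleteRow ht' htop hboth 0)
  exact hy (ih l (by omega) h1 h2)

section Transfer

variable {V W : Type*} [Fintype W] {H : SimpleGraph W} {G : SimpleGraph V} [DecidableRel G.Adj]

open Classical in
theorem natCast_ncard_eq_sum (S : Set W) : (S.ncard : ZMod 2) = ∑ w, if w ∈ S then 1 else 0 := by
  rw [Finset.sum_boole, Set.ncard_eq_toFinset_card', ← Set.filter_mem_univ_eq_toFinset]

/-- A rank function on the image of an embedding induces an acyclic orientation. -/
theorem ParityRankable.hasAcyclicTOddOrientation (φ : H ↪g G) {T : Set W} (hP : CondP H T)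
    {s : Bool → V → ZMod 2} (hs : ∀ w, s false (φ w) = 1 ↔ w ∈ T)
    (hs' : ∀ w, s false (φ w) + s true (φ w) = (vdeg H w : ZMod 2))
    (h : ParityRankable G (Finset.univ.map φ.toEmbedding) s) : HasAcyclicTOddOrientation H T := by
  classical
  have h01 : ∀ x : ZMod 2, x = if x = 1 then 1 else 0 := by decide
  obtain ⟨f, hf, hf'⟩ := h
    (by
      intro v hv
      obtain ⟨w, -, rfl⟩ := Finset.mem_map.1 hv
      rw [Finset.sum_map]
      simp only [RelEmbedding.coe_toEmbedding, hs', vdeg, natCast_ncard_eq_sum, φ.map_adj_iff,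
        mem_neighborSet])
    (by
      have h1 : (T.ncard : ZMod 2) = ∑ w, s false (φ w) := by
        rw [natCast_ncard_eq_sum]
        refine Finset.sum_congr rfl fun w _ => ?_
        rw [h01 (s false (φ w))]
        simp only [hs]
      have h2 : ∀ e : Sym2 W, e.map φ ∈ G.edgeSet ↔ e ∈ H.edgeSet := by
        intro e
        induction e with | _ a b => simp
      have h3 := ZMod.natCast_eq_zero_iff_even.2 hP
      push_cast at h3
      rw [natCast_ncard_eq_sum, h1, ← CharTwo.sub_eq_add, sub_eq_zero] at h3
      rw [Finset.sum_map, Finset.sym2_map, Finset.sum_map, Finset.sym2_univ]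
      refine h3.symm.trans (Finset.sum_congr rfl fun e _ => ?_)
      by_cases he : e ∈ H.edgeSet
      · exact (if_pos he).trans (if_pos ((h2 e).2 he)).symm
      · exact (if_neg he).trans (if_neg (mt (h2 e).1 he)).symm)
  simp only [Finset.mem_map, Finset.mem_univ, true_and, forall_exists_index,
    forall_apply_eq_imp_iff, RelEmbedding.coe_toEmbedding, φ.map_adj_iff, Finset.sum_map] at hf hf'
  refine ⟨⟨fun u v => H.Adj u v ∧ f (φ u) < f (φ v), fun u v h => h.1, fun u v h => ?_⟩, ?_, ?_⟩
  · have := hf u v h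
    simp only [h, h.symm, true_and, not_lt]
    omega
  · intro u hu
    have : ∀ v, Relation.TransGen (fun u v => H.Adj u v ∧ f (φ u) < f (φ v)) u v →
        f (φ u) < f (φ v) := by
      intro v h
      induction h with
      | single h => exact h.2
      | tail _ h ih => exact ih.trans h.2
    exact lt_irrefl _ (this u hu)
  · intro w
    rw [← hs, hf', ← ZMod.natCast_eq_one_iff_odd, GraphOrientation.indeg, natCast_ncard_eq_sum]
    simp only [Set.mem_ofPred_eq, H.adj_comm w]
    congr!

end Transfer

/-- The embedding of a finite cylinder into the half-infinite one. -/
def cylinderEmbedding (n q : ℕ) :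
    (cycleGraph (n + 4) □ pathGraph q) ↪g infiniteCylinder n where
  toFun w := ((w.1 : Fin (n + 4)), w.2.val)
  inj' := by
    rintro ⟨a, b⟩ ⟨a', b'⟩ h
    have h' := Prod.ext_iff.1 h
    exact Prod.ext h'.1 (Fin.ext h'.2)
  map_rel_iff' := by
    rintro ⟨a, b⟩ ⟨a', b'⟩
    have h : (cycleGraph (n + 4)).Adj a a' ↔ a' = a + 1 ∨ a = a' + 1 := by
      rw [cycleGraph_adj, sub_eq_iff_eq_add', sub_eq_iff_eq_add', or_comm]
    have h' : (pathGraph q).Adj b b' ↔ b'.val = b.val + 1 ∨ b.val = b'.val + 1 := by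
      rw [pathGraph_adj]
      omega
    rw [boxProd_adj, h, h', ← Fin.val_inj (a := b)]
    constructor
    · rintro (⟨h1, h2⟩ | ⟨h1, h2⟩)
      · exact Or.inl ⟨h2, h1⟩
      · exact Or.inr ⟨h2, h1⟩
    · rintro (⟨h1, h2⟩ | ⟨h1, h2⟩)
      · exact Or.inl ⟨h2, h1⟩
      · exact Or.inr ⟨h2, h1⟩

theorem map_cylinderEmbedding (n q : ℕ) :
    Finset.univ.map (cylinderEmbedding n q).toEmbedding = rows n q := by
  ext ⟨i, k⟩
  rw [mem_rows, Finset.mem_map]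
  constructor
  · rintro ⟨⟨a, b⟩, -, h⟩
    cases h
    exact b.2
  · intro hk
    exact ⟨(i, ⟨k, hk⟩), Finset.mem_univ _, rfl⟩

theorem natCast_vdeg_cylinder {n q : ℕ} (w : Fin (n + 4) × Fin q) :
    (vdeg (cycleGraph (n + 4) □ pathGraph q) w : ZMod 2) =
      (if w.2.val = 0 then 1 else 0) + (if w.2.val + 1 = q then 1 else 0) := by
  classical
  obtain ⟨a, b⟩ := w
  have hdeg : (cycleGraph (n + 4)).degree a = 2 := cycleGraph_degree_three_le
  have h1 : ((pathGraph q).degree b : ZMod 2) =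
      (if b.val = 0 then 1 else 0) + (if b.val + 1 = q then 1 else 0) := by
    have h2 : ((pathGraph q).degree b : ZMod 2) = ∑ j : Fin q,
        ((if j.val = b.val + 1 then 1 else 0) + if j.val + 1 = b.val then 1 else 0) := by
      rw [← card_neighborFinset_eq_degree, neighborFinset_eq_filter, ← Finset.sum_boole]
      refine Finset.sum_congr rfl fun j _ => ?_
      rw [pathGraph_adj]
      grind
    have h3 : (∑ j ∈ Finset.range q, if j + 1 = b.val then (1 : ZMod 2) else 0) =
        if b.val = 0 then 0 else 1 := by
      rcases hb : b.val with _ | k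
      · simp
      · have := b.2
        simp only [Nat.add_right_cancel_iff, Finset.sum_ite_eq', Finset.mem_range]
        rw [if_pos (by omega), if_neg (by omega)]
    rw [h2, Fin.sum_univ_eq_sum_range
      (fun j => (if j = b.val + 1 then 1 else 0) + if j + 1 = b.val then 1 else 0),
      Finset.sum_add_distrib, h3, Finset.sum_ite_eq']
    have := b.2
    have h4 : b.val + 1 ∈ Finset.range q ↔ ¬ (b.val + 1 = q) := by
      rw [Finset.mem_range]; omega
    simp only [h4]
    split_ifs <;> decide
  rw [vdeg, Set.ncard_eq_toFinset_card', ← neighborFinset_def, card_neighborFinset_eq_degree,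
    degree_boxProd]
  simp only [hdeg, Nat.cast_add, h1]
  rw [show ((2 : ℕ) : ZMod 2) = 0 from rfl, zero_add]

end Cylinder

/-- Lemma (even cylinders): for `p ≥ 4` even and `q ≥ 1`, the cylinder `C_p □ P_q`
admits an acyclic `T`-odd orientation for every `T` satisfying `𝒫 𝒮 𝒮̄`. -/
theorem cylinder_even (p q : ℕ) (hp : 4 ≤ p) (hpeven : Even p) (hq : 1 ≤ q)
    (T : Set (Fin p × Fin q))
    (hP : CondP (cycleGraph p □ pathGraph q) T)
    (hS : CondS (cycleGraph p □ pathGraph q) T)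
    (hSbar : CondSbar (cycleGraph p □ pathGraph q) T) :
    HasAcyclicTOddOrientation (cycleGraph p □ pathGraph q) T := by
  classical
  obtain ⟨n, rfl⟩ := Nat.exists_eq_add_of_le' hp
  obtain ⟨m, rfl⟩ := Nat.exists_eq_add_of_le' hq
  set φ := cylinderEmbedding n (m + 1) with hφ
  obtain ⟨s, hs⟩ : ∃ s : Bool → ZMod (n + 4) × ℕ → ZMod 2, ∀ t w, s t (φ w) =
      (if w ∈ T then 1 else 0) +
        if t then (vdeg (cycleGraph (n + 4) □ pathGraph (m + 1)) w : ZMod 2) else 0 :=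
    ⟨fun t => Function.extend φ (fun w => (if w ∈ T then 1 else 0) +
      if t then (vdeg (cycleGraph (n + 4) □ pathGraph (m + 1)) w : ZMod 2) else 0) 0,
      fun t w => φ.injective.extend_apply _ _ _⟩
  have hdeg : ∀ w, s false (φ w) + s true (φ w) =
      (vdeg (cycleGraph (n + 4) □ pathGraph (m + 1)) w : ZMod 2) := fun w => by
    simp only [hs, Bool.false_eq_true, if_false, if_true, add_zero]
    rw [← add_assoc, CharTwo.add_self_eq_zero, zero_add]
  refine ParityRankable.hasAcyclicTOddOrientation φ hP (s := s) (fun w => ?_) hdeg ?_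
  · rw [hs]; simp
  rw [hφ, map_cylinderEmbedding]
  refine parityRankable_rows hpeven.two_dvd m (fun i k hk => ?_) ?_
  · exact (hdeg (i, ⟨k, hk⟩)).trans (natCast_vdeg_cylinder _)
  · rintro (_ | _)
    · obtain ⟨w, hw⟩ := hS.1
      exact ⟨w.1, w.2, w.2.2, (hs false w).trans (by simpa [sourceSet] using hw)⟩
    · obtain ⟨w, hw⟩ := hSbar.1
      refine ⟨w.1, w.2, w.2.2, (hs true w).trans ?_⟩
      rw [if_pos rfl]
      rcases hw with ⟨hw, h⟩ | ⟨hw, h⟩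
      · rw [if_pos hw, ZMod.natCast_eq_one_iff_odd.2 h]; decide
      · rw [if_neg hw, ZMod.natCast_eq_zero_iff_even.2 h, add_zero]
end
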